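/- arXiv:1003.4762 — 2 statements merged into one kernel-verified Lean document; each statement's English description precedes it below -/
import Mathlib

section
/- Let F = FreeGroup X be a free group on an infinite type X. An automorphism σ of F has small conjugacy class in Aut F (i.e. the conjugacy class of σ in Aut F has cardinality at most #X) if and only if σ is an inner automorphism of F. -/
open Cardinal

namespace FreeGroup

variable {X : Type*}

/-- A letter raised to the power `±1` is the class of a one-letter word. -/
theorem exists_of_zpow_eq_mk (y : X) {ε : ℤ} (hε : ε = 1 ∨ ε = -1) :
    ∃ b, of y ^ ε = mk [(y, b)] := by
  rcases hε with rfl | rfl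
  · exact ⟨true, by simp [of]⟩
  · exact ⟨false, by simp [of, inv_mk, invRev]⟩

theorem exists_mk_singleton_eq_zpow (y : X) (b : Bool) : ∃ k : ℤ, mk [(y, b)] = of y ^ k := by
  cases b
  · exact ⟨-1, by simp [of, inv_mk, invRev]⟩
  · exact ⟨1, by simp [of]⟩

theorem exists_mk_eq_zpow_of_forall {y : X} (L : List (X × Bool)) (hL : ∀ a ∈ L, a.1 = y) :
    ∃ k : ℤ, mk L = of y ^ k := by
  induction L with
  | nil => exact ⟨0, by simp [one_eq_mk]⟩
  | cons a L ih =>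
    obtain ⟨k, hk⟩ := ih fun b hb ↦ hL b (List.mem_cons_of_mem _ hb)
    obtain ⟨x, b⟩ := a
    obtain rfl : x = y := hL (x, b) List.mem_cons_self
    obtain ⟨j, hj⟩ := exists_mk_singleton_eq_zpow x b
    refine ⟨j + k, ?_⟩
    rw [zpow_add, ← hj, ← hk, mul_mk, List.singleton_append]

theorem mk_cons (a : X × Bool) (L : List (X × Bool)) : mk (a :: L) = mk [a] * mk L := by
  rw [mul_mk, List.singleton_append]

section Weight

variable [DecidableEq X] (p : X → Bool)

/-- The number of letters of the reduced word of `g` that satisfy `p`. -/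
def weight (g : FreeGroup X) : ℕ := g.toWord.countP fun a ↦ p a.1

theorem weight_one : weight p 1 = 0 := by simp [weight]

theorem weight_mul_le (g h : FreeGroup X) : weight p (g * h) ≤ weight p g + weight p h := by
  simpa [weight] using (toWord_mul_sublist g h).countP_le (p := fun a ↦ p a.1)

theorem weight_pow_le (g : FreeGroup X) (n : ℕ) : weight p (g ^ n) ≤ n * weight p g := by
  induction n with
  | zero => simp [weight_one]
  | succ n ih =>
    rw [pow_succ, add_mul, one_mul]
    exact (weight_mul_le p _ _).trans (by omega)

theorem weight_mk_le (L : List (X × Bool)) : weight p (mk L) ≤ L.countP fun a ↦ p a.1 := by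
  rw [weight, toWord_mk]
  exact (reduce.red (L := L)).sublist.countP_le

theorem weight_mk_pow {L : List (X × Bool)} (hL : IsCyclicallyReduced L) (n : ℕ) :
    weight p (mk L ^ n) = n * L.countP fun a ↦ p a.1 := by
  rw [weight, toWord_pow, toWord_mk, hL.isReduced.reduce_eq,
    (hL.flatten_replicate n).isReduced.reduce_eq, List.countP_flatten]
  simp

/-- The weight of a cyclically reduced word is at most the growth rate of the weights of the powers
of any conjugate. -/
theorem countP_le_of_weight_pow_le {L : List (X × Bool)} (hL : IsCyclicallyReduced L)
    (h v : FreeGroup X) (hv : v = h * mk L * h⁻¹) {B D : ℕ}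
    (hB : ∀ n : ℕ, weight p (v ^ n) ≤ B + n * D) : (L.countP fun a ↦ p a.1) ≤ D := by
  by_contra! hlt
  set n := weight p h⁻¹ + weight p h + B + 1 with hn
  have h1 : mk L ^ n = h⁻¹ * v ^ n * h := by
    rw [hv, conj_pow]; group
  have h2 := weight_mk_pow p hL n
  rw [h1] at h2
  have h3 := weight_mul_le p (h⁻¹ * v ^ n) h
  have h4 := weight_mul_le p h⁻¹ (v ^ n)
  have h5 := hB n
  have h6 : n * (D + 1) ≤ n * L.countP fun a ↦ p a.1 := Nat.mul_le_mul_left n hlt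
  rw [mul_add] at h6
  omega

theorem countP_le_weight_of_conj {L : List (X × Bool)} (hL : IsCyclicallyReduced L)
    {h d : FreeGroup X} (hd : mk L = h * d * h⁻¹) : (L.countP fun a ↦ p a.1) ≤ weight p d := by
  refine countP_le_of_weight_pow_le p hL h⁻¹ d (by rw [hd]; group) (B := 0) fun n ↦ ?_
  simpa using weight_pow_le p d n

/-- Conjugates of powers of `of y` are recognised by the growth of their powers. -/
theorem exists_conj_zpow_of_weight_pow_le (y : X) (v : FreeGroup X) {B : ℕ}
    (hB : ∀ n : ℕ, weight (fun x ↦ x ≠ y) (v ^ n) ≤ B) :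
    ∃ (k : ℤ) (h : FreeGroup X), v = h * of y ^ k * h⁻¹ := by
  have hL := reduceCyclically.isCyclicallyReduced (isReduced_toWord (x := v))
  have hv : v = mk (reduceCyclically.conjugator v.toWord) *
      mk (reduceCyclically v.toWord) * (mk (reduceCyclically.conjugator v.toWord))⁻¹ := by
    rw [inv_mk, mul_mk, mul_mk, reduceCyclically.conj_conjugator_reduceCyclically, mk_toWord]
  have h0 := countP_le_of_weight_pow_le _ hL _ v hv (B := B) (D := 0) (by simpa using hB)
  rw [Nat.le_zero, List.countP_eq_zero] at h0
  obtain ⟨k, hk⟩ := exists_mk_eq_zpow_of_forall (y := y) _ (fun a ha ↦ by simpa using h0 a ha)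
  exact ⟨k, _, by rw [← hk]; exact hv⟩

end Weight

section Words

variable [DecidableEq X]

theorem IsReduced.invRev {L : List (X × Bool)} (hL : IsReduced L) :
    IsReduced (FreeGroup.invRev L) := by
  rw [isReduced_iff_reduce_eq] at hL ⊢
  rw [reduce_invRev, hL]

theorem isCyclicallyReduced_letter_mul_conj {x y : X} (b c : Bool)
    {L : List (X × Bool)} (hL : IsReduced L) (hne : L ≠ [])
    (hhead : ∀ a ∈ L.head?, a.1 ≠ y) (hlast : ∀ a ∈ L.getLast?, a.1 ≠ x) :
    IsCyclicallyReduced ((y, b) :: (L ++ (x, c) :: FreeGroup.invRev L)) := by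
  have hinv := hL.invRev
  have hhead' : ∀ a ∈ (FreeGroup.invRev L).head?, a.1 ≠ x := by
    intro a ha
    simp only [FreeGroup.invRev, List.head?_reverse, List.getLast?_map, Option.mem_def,
      Option.map_eq_some_iff] at ha
    obtain ⟨a', ha', rfl⟩ := ha
    exact hlast a' ha'
  have hlast' : ∀ a ∈ (FreeGroup.invRev L).getLast?, a.1 ≠ y := by
    intro a ha
    simp only [FreeGroup.invRev, List.getLast?_reverse, List.head?_map, Option.mem_def,
      Option.map_eq_some_iff] at ha
    obtain ⟨a', ha', rfl⟩ := ha
    exact hhead a' ha'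
  have hne' : FreeGroup.invRev L ≠ [] := by
    simpa [FreeGroup.invRev] using hne
  refine ⟨?_, ?_⟩
  · rw [IsReduced, List.isChain_cons, List.isChain_append, List.isChain_cons]
    refine ⟨?_, hL, ⟨?_, hinv⟩, ?_⟩
    · intro a ha h
      rw [List.head?_append_of_ne_nil _ hne] at ha
      exact absurd h.symm (hhead a ha)
    · intro a ha h
      exact absurd h.symm (hhead' a ha)
    · intro a ha d hd h
      simp only [List.head?_cons, Option.mem_def, Option.some.injEq] at hd
      subst hd
      exact absurd h (hlast a ha)
  · intro a ha d hd h
    simp only [List.head?_cons, Option.mem_def, Option.some.injEq] at hd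
    subst hd
    have : (y, b) :: (L ++ (x, c) :: FreeGroup.invRev L) =
        ((y, b) :: L ++ [(x, c)]) ++ FreeGroup.invRev L := by simp
    rw [this, List.getLast?_append_of_ne_nil _ hne'] at ha
    exact absurd h (hlast' a ha)

theorem eq_zpow_mul_zpow_of_conj_mk {x y : X} (b c : Bool) {d : FreeGroup X}
    (hd : weight (fun _ ↦ true) d ≤ 2) (N : ℕ) (L : List (X × Bool)) (hN : L.length ≤ N)
    (hL : IsReduced L) (h : FreeGroup X)
    (hconj : mk [(y, b)] * (mk L * mk [(x, c)] * (mk L)⁻¹) = h * d * h⁻¹) :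
    ∃ i j : ℤ, mk L = of y ^ i * of x ^ j := by
  induction N generalizing L h with
  | zero =>
    obtain rfl : L = [] := by simpa using hN
    exact ⟨0, 0, by simp [one_eq_mk]⟩
  | succ N ih =>
    rcases eq_or_ne L [] with rfl | hne
    · exact ⟨0, 0, by simp [one_eq_mk]⟩
    by_cases hhead : ∀ a ∈ L.head?, a.1 ≠ y
    · by_cases hlast : ∀ a ∈ L.getLast?, a.1 ≠ x
      · have hcyc := isCyclicallyReduced_letter_mul_conj b c hL hne hhead hlast
        have heq : mk ((y, b) :: (L ++ (x, c) :: FreeGroup.invRev L)) = h * d * h⁻¹ := by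
          rw [← hconj, inv_mk, mul_mk, mul_mk, mul_mk]
          simp
        have := (countP_le_weight_of_conj (fun _ ↦ true) hcyc heq).trans hd
        have hpos := List.length_pos_of_ne_nil hne
        simp at this
        omega
      · push Not at hlast
        obtain ⟨⟨z, e⟩, ha, rfl⟩ := hlast
        obtain ⟨L, rfl⟩ := List.mem_getLast?_eq_getLast ha |> fun ⟨hne, h⟩ ↦
          (⟨L.dropLast, by rw [h, List.dropLast_append_getLast]⟩ : ∃ L', L = L' ++ [(z, e)])
        obtain ⟨k, hk⟩ := exists_mk_singleton_eq_zpow z e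
        obtain ⟨m, hm⟩ := exists_mk_singleton_eq_zpow z c
        obtain ⟨i, j, hij⟩ := ih L (by simpa using hN) (hL.infix ⟨[], [(z, e)], rfl⟩) h (by
          rw [← hconj, ← mul_mk (L₁ := L), hk, hm]
          group)
        exact ⟨i, j + k, by rw [← mul_mk, hij, hk, zpow_add, mul_assoc]⟩
    · push Not at hhead
      obtain ⟨⟨z, e⟩, ha, rfl⟩ := hhead
      obtain ⟨L, rfl⟩ : ∃ L', L = (z, e) :: L' := by
        cases L with
        | nil => simp at ha
        | cons a L => exact ⟨L, by simp at ha; rw [ha]⟩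
      obtain ⟨k, hk⟩ := exists_mk_singleton_eq_zpow z e
      obtain ⟨m, hm⟩ := exists_mk_singleton_eq_zpow z b
      obtain ⟨i, j, hij⟩ := ih L (by simpa using hN) (hL.infix ⟨[(z, e)], [], by simp⟩)
        (of z ^ (-k) * h) (by
          have : of z ^ (-k) * h * d * (of z ^ (-k) * h)⁻¹ =
            of z ^ (-k) * (h * d * h⁻¹) * of z ^ k := by group
          rw [this, ← hconj, mk_cons _ L, hk, hm]
          group)
      exact ⟨k + i, j, by rw [mk_cons, hij, hk, zpow_add, mul_assoc]⟩

/-- If `y ^ ε * (g * x ^ δ * g⁻¹)` with `ε, δ = ±1` is conjugate to a word of length at most `2`,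
then `g` is a power of `y` times a power of `x`. -/
theorem eq_zpow_mul_zpow_of_conj {x y : X} {ε δ : ℤ} (hε : ε = 1 ∨ ε = -1)
    (hδ : δ = 1 ∨ δ = -1) {d : FreeGroup X} (hd : weight (fun _ ↦ true) d ≤ 2)
    {g h : FreeGroup X} (hconj : of y ^ ε * (g * of x ^ δ * g⁻¹) = h * d * h⁻¹) :
    ∃ i j : ℤ, g = of y ^ i * of x ^ j := by
  obtain ⟨b, hb⟩ := exists_of_zpow_eq_mk y hε
  obtain ⟨c, hc⟩ := exists_of_zpow_eq_mk x hδ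
  have := eq_zpow_mul_zpow_of_conj_mk b c hd _ g.toWord le_rfl isReduced_toWord h
    (by rw [mk_toWord, ← hb, ← hc, hconj])
  rwa [mk_toWord] at this

end Words

section Transvection

variable [DecidableEq X]

/-- The endomorphism multiplying each letter `x ≠ y` on the right by `y ^ f x`. -/
def transvectionHom (y : X) (f : X → ℤ) : FreeGroup X →* FreeGroup X :=
  lift fun x ↦ of x * of y ^ (if x = y then 0 else f x)

theorem transvectionHom_of_self (y : X) (f : X → ℤ) : transvectionHom y f (of y) = of y := by
  simp [transvectionHom]

theorem transvectionHom_of {x y : X} (hxy : x ≠ y) (f : X → ℤ) :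
    transvectionHom y f (of x) = of x * of y ^ f x := by
  simp [transvectionHom, hxy]

theorem transvectionHom_comp (y : X) (f g : X → ℤ) :
    (transvectionHom y f).comp (transvectionHom y g) = transvectionHom y (f + g) := by
  ext x
  rcases eq_or_ne x y with rfl | hxy
  · simp [transvectionHom_of_self]
  · simp [transvectionHom_of hxy, transvectionHom_of_self, zpow_add, mul_assoc]

theorem transvectionHom_zero (y : X) : transvectionHom y 0 = MonoidHom.id _ := by
  ext x
  simp [transvectionHom]

/-- The automorphism multiplying each letter `x ≠ y` on the right by `y ^ f x`. -/
def transvection (y : X) (f : X → ℤ) : MulAut (FreeGroup X) :=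
  MonoidHom.toMulEquiv (transvectionHom y f) (transvectionHom y (-f))
    (by rw [transvectionHom_comp, neg_add_cancel, transvectionHom_zero])
    (by rw [transvectionHom_comp, add_neg_cancel, transvectionHom_zero])

theorem transvection_of_self (y : X) (f : X → ℤ) : transvection y f (of y) = of y :=
  transvectionHom_of_self y f

theorem transvection_of {x y : X} (hxy : x ≠ y) (f : X → ℤ) :
    transvection y f (of x) = of x * of y ^ f x :=
  transvectionHom_of hxy f

theorem transvection_mul (y : X) (f g : X → ℤ) :
    transvection y f * transvection y g = transvection y (f + g) := by
  ext w
  exact DFunLike.congr_fun (transvectionHom_comp y f g) w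

theorem transvection_inv (y : X) (f : X → ℤ) :
    (transvection y f)⁻¹ = transvection y (-f) := by
  rw [inv_eq_iff_mul_eq_one, transvection_mul, add_neg_cancel]
  ext w
  exact DFunLike.congr_fun (transvectionHom_zero y) w

theorem weight_of_zpow_self (y : X) (k : ℤ) : weight (fun x ↦ x ≠ y) (of y ^ k) = 0 := by
  have hpow (n : ℕ) : weight (fun x ↦ x ≠ y) (of y ^ n) = 0 := by simp [weight]
  obtain ⟨n, rfl | rfl⟩ := k.eq_nat_or_neg
  · rw [zpow_natCast, hpow]
  · have := hpow n
    simp only [weight, List.countP_eq_zero] at this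
    simp [weight, invRev]

theorem weight_transvection_le (y : X) (f : X → ℤ) (w : FreeGroup X) :
    weight (fun x ↦ x ≠ y) (transvection y f w) ≤ weight (fun x ↦ x ≠ y) w := by
  suffices ∀ L : List (X × Bool), weight (fun x ↦ x ≠ y) (transvection y f (mk L)) ≤
      L.countP fun a ↦ a.1 ≠ y by
    have := this w.toWord
    rwa [mk_toWord] at this
  intro L
  induction L with
  | nil => simp [← one_eq_mk, weight_one]
  | cons a L ih =>
    rw [mk_cons, _root_.map_mul]
    refine (weight_mul_le _ _ _).trans ?_
    rw [List.countP_cons, add_comm]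
    refine add_le_add ih ?_
    obtain ⟨x, b⟩ := a
    rcases eq_or_ne x y with rfl | hxy
    · obtain ⟨k, hk⟩ := exists_mk_singleton_eq_zpow x b
      rw [hk, map_zpow, transvection_of_self, weight_of_zpow_self]
      exact Nat.zero_le _
    · have hle (c : Bool) : weight (fun x ↦ x ≠ y) (mk [(x, c)]) ≤ 1 :=
        (weight_mk_le _ _).trans (by simp [List.countP_cons]; split <;> simp)
      have hx : mk [(x, true)] = of x := rfl
      have hx' : mk [(x, false)] = (of x)⁻¹ := by simp [of, inv_mk, invRev]
      rw [if_pos (by simpa using hxy)]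
      cases b
      · rw [hx', _root_.map_inv, transvection_of hxy, mul_inv_rev, ← zpow_neg]
        refine (weight_mul_le _ _ _).trans ?_
        have := weight_of_zpow_self y (-f x)
        have := hle false
        rw [hx'] at this
        omega
      · rw [hx, transvection_of hxy]
        refine (weight_mul_le _ _ _).trans ?_
        have := weight_of_zpow_self y (f x)
        have := hle true
        rw [hx] at this
        omega

theorem exists_conj_zpow_of_commute_transvection {σ : MulAut (FreeGroup X)} {x y : X}
    (hxy : x ≠ y) {f : X → ℤ} (hf : f x = 1) (hcomm : Commute (transvection y f) σ) :
    ∃ (k : ℤ) (h : FreeGroup X), σ (of y) = h * of y ^ k * h⁻¹ := by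
  set ρ := transvection y f with hρ
  have hpow (n : ℕ) : (ρ ^ n) (of x) = of x * of y ^ n := by
    induction n with
    | zero => simp
    | succ n ih =>
      rw [pow_succ', MulAut.mul_apply, ih, _root_.map_mul, map_pow, hρ, transvection_of_self,
        transvection_of hxy, hf, zpow_one, pow_succ', mul_assoc]
  have hweight (n : ℕ) (w : FreeGroup X) :
      weight (fun x ↦ x ≠ y) ((ρ ^ n) w) ≤ weight (fun x ↦ x ≠ y) w := by
    induction n with
    | zero => simp
    | succ n ih =>
      rw [pow_succ', MulAut.mul_apply]
      exact (weight_transvection_le y f _).trans ih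
  refine exists_conj_zpow_of_weight_pow_le y _
    (B := weight (fun x ↦ x ≠ y) (σ (of x))⁻¹ + weight (fun x ↦ x ≠ y) (σ (of x))) fun n ↦ ?_
  have heq : (ρ ^ n) (σ (of x)) = σ (of x) * σ (of y) ^ n := by
    rw [← map_pow, ← _root_.map_mul, ← hpow, ← MulAut.mul_apply, ← MulAut.mul_apply,
      (hcomm.pow_left n).eq]
  rw [show σ (of y) ^ n = (σ (of x))⁻¹ * (ρ ^ n) (σ (of x)) by rw [heq]; group]
  exact (weight_mul_le _ _ _).trans (add_le_add_right (hweight n _) _)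

end Transvection

section Conjugation

/-- Every automorphic image of a free generator is sent by `σ` to a conjugate of itself or of its
inverse. -/
def PreservesPrimitiveClasses (σ : MulAut (FreeGroup X)) : Prop :=
  ∀ (a : MulAut (FreeGroup X)) (y : X), ∃ k : ℤ, (k = 1 ∨ k = -1) ∧
    ∃ h : FreeGroup X, σ (a (of y)) = h * a (of y) ^ k * h⁻¹

theorem PreservesPrimitiveClasses.conj_mul {σ : MulAut (FreeGroup X)}
    (hσ : PreservesPrimitiveClasses σ) (g : FreeGroup X) :
    PreservesPrimitiveClasses (MulAut.conj g * σ) := by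
  intro a y
  obtain ⟨k, hk, h, hh⟩ := hσ a y
  exact ⟨k, hk, g * h, by rw [MulAut.mul_apply, hh, MulAut.conj_apply]; group⟩

variable [DecidableEq X]

/-- The exponent sum of the letter `y`. -/
def exponentSum (y : X) : FreeGroup X →* Multiplicative ℤ :=
  lift fun x ↦ Multiplicative.ofAdd (if x = y then 1 else 0)

theorem exponentSum_of_self (y : X) : exponentSum y (of y) = Multiplicative.ofAdd 1 := by
  simp [exponentSum]

theorem exponentSum_of {x y : X} (hxy : x ≠ y) : exponentSum y (of x) = 1 := by
  simp [exponentSum, hxy]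

theorem exponentSum_conj (y : X) (g h : FreeGroup X) :
    exponentSum y (h * g * h⁻¹) = exponentSum y g := by
  simp

theorem ofAdd_one_zpow_inj {m n : ℤ}
    (h : (Multiplicative.ofAdd (1 : ℤ)) ^ m = Multiplicative.ofAdd (1 : ℤ) ^ n) : m = n := by
  simpa [← ofAdd_zsmul] using h

theorem eq_one_or_neg_one_of_forall_conj_zpow {σ : MulAut (FreeGroup X)} {k : X → ℤ}
    {h : X → FreeGroup X} (hσ : ∀ x, σ (of x) = h x * of x ^ k x * (h x)⁻¹) (y : X) :
    k y = 1 ∨ k y = -1 := by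
  have hcomp : (exponentSum y).comp σ.toMonoidHom =
      (zpowGroupHom (k y)).comp (exponentSum y) := by
    ext x
    rcases eq_or_ne x y with rfl | hxy
    · simp [hσ, exponentSum_of_self]
    · simp [hσ, exponentSum_of hxy]
  have hy := DFunLike.congr_fun hcomp (σ⁻¹ (of y))
  have hinv : σ (σ⁻¹ (of y)) = of y := MulAut.apply_inv_self _ σ (of y)
  simp only [MonoidHom.comp_apply, MulEquiv.toMonoidHom_eq_coe, MonoidHom.coe_coe, hinv,
    exponentSum_of_self, zpowGroupHom_apply] at hy
  have hmul : k y * (exponentSum y (σ⁻¹ (of y))).toAdd = 1 := by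
    have := congrArg Multiplicative.toAdd hy
    simpa using this.symm
  exact Int.eq_one_or_neg_one_of_mul_eq_one hmul

theorem weight_true_le_two {x y : X} {k : ℤ} (hk : k = 1 ∨ k = -1) :
    weight (fun _ ↦ true) ((of x * of y) ^ k) ≤ 2 := by
  rcases hk with rfl | rfl
  · rw [zpow_one]
    exact (weight_mul_le _ _ _).trans (by simp [weight])
  · rw [zpow_neg_one, mul_inv_rev]
    exact (weight_mul_le _ _ _).trans (by simp [weight, invRev])

theorem transvection_one_of {x y : X} (hxy : x ≠ y) :
    transvection y (fun _ ↦ 1) (of x) = of x * of y := by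
  rw [transvection_of hxy, zpow_one]

/-- An automorphism inverting three distinct letters reverses the cyclic order of their product. -/
theorem not_preservesPrimitiveClasses_of_inv {σ : MulAut (FreeGroup X)} {x y z : X} (hxy : x ≠ y)
    (hxz : x ≠ z) (hyz : y ≠ z) (hx : σ (of x) = (of x)⁻¹) (hy : σ (of y) = (of y)⁻¹)
    (hz : σ (of z) = (of z)⁻¹) : ¬ PreservesPrimitiveClasses σ := by
  intro hσ
  obtain ⟨k, -, h, hh⟩ := hσ (transvection z (fun t ↦ if t = x then 1 else 0) *
    transvection y (fun t ↦ if t = x then 1 else 0)) x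
  rw [MulAut.mul_apply, transvection_of hxy, if_pos rfl, zpow_one, _root_.map_mul,
    transvection_of hxz, transvection_of hyz, if_pos rfl, if_neg hxy.symm, zpow_one, zpow_zero,
    mul_one] at hh
  simp only [_root_.map_mul, hx, hy, hz] at hh
  let A : Equiv.Perm (Fin 3) := Equiv.swap 0 1
  let C : Equiv.Perm (Fin 3) := Equiv.swap 1 2
  have := congrArg (lift fun t ↦ if t = x then A else if t = y then C else A⁻¹ * C⁻¹) hh
  simp [hxy.symm, hxz.symm, hyz.symm] at this
  revert this
  decide

/-- An automorphism preserving, up to inversion, the conjugacy classes of primitive elements is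
inner. -/
theorem PreservesPrimitiveClasses.exists_eq_conj [Infinite X] {σ : MulAut (FreeGroup X)}
    (hσ : PreservesPrimitiveClasses σ) : ∃ g, σ = MulAut.conj g := by
  obtain ⟨y⟩ : Nonempty X := inferInstance
  obtain ⟨ε, hε, g, hg⟩ := hσ 1 y
  rw [MulAut.one_apply] at hg
  suffices ∃ g', MulAut.conj g⁻¹ * σ = MulAut.conj g' by
    obtain ⟨g', h⟩ := this
    exact ⟨g * g', by
      rw [_root_.map_mul, ← h, ← mul_assoc, ← _root_.map_mul, mul_inv_cancel,
      _root_.map_one, one_mul]⟩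
  replace hσ := hσ.conj_mul g⁻¹
  replace hg : (MulAut.conj g⁻¹ * σ) (of y) = of y ^ ε := by
    rw [MulAut.mul_apply, hg, MulAut.conj_apply]; group
  generalize MulAut.conj g⁻¹ * σ = σ at hσ hg
  clear g
  have hform (x : X) (hxy : x ≠ y) : ∃ a : ℤ, σ (of x) = of y ^ a * of x ^ ε * of y ^ (-a) := by
    obtain ⟨δ, hδ, h, hh⟩ := hσ 1 x
    obtain ⟨k, hk, u, hu⟩ := hσ (transvection y fun _ ↦ 1) x
    rw [MulAut.one_apply] at hh
    rw [transvection_one_of hxy, _root_.map_mul, hh, hg] at hu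
    have hεk : ε = k := by
      have := congrArg (exponentSum y) hu
      rw [exponentSum_conj, _root_.map_mul, exponentSum_conj, map_zpow, map_zpow, map_zpow,
        _root_.map_mul, exponentSum_of hxy, exponentSum_of_self, one_mul, one_zpow, one_mul] at this
      exact ofAdd_one_zpow_inj this
    have hδk : δ = k := by
      have := congrArg (exponentSum x) hu
      rw [exponentSum_conj, _root_.map_mul, exponentSum_conj, map_zpow, map_zpow, map_zpow,
        _root_.map_mul, exponentSum_of hxy.symm, exponentSum_of_self, mul_one, one_zpow,
        mul_one] at this
      exact ofAdd_one_zpow_inj this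
    subst hεk hδk
    obtain ⟨i, j, rfl⟩ := eq_zpow_mul_zpow_of_conj (y := y) (x := x) (g := h)
      (h := of y ^ δ * u) hε hδ (weight_true_le_two (x := x) (y := y) hk) (by
        have : of y ^ δ * u * (of x * of y) ^ δ * (of y ^ δ * u)⁻¹ =
          of y ^ δ * (u * (of x * of y) ^ δ * u⁻¹) * (of y ^ δ)⁻¹ := by group
        rw [this, ← hu]; group)
    exact ⟨i, by rw [hh]; group⟩
  choose! a ha using hform
  obtain ⟨x, hxy⟩ := exists_ne y
  have hconst (z : X) (hzy : z ≠ y) : a z = a x := by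
    rcases eq_or_ne z x with rfl | hzx
    · rfl
    obtain ⟨k, hk, u, hu⟩ := hσ (transvection x fun _ ↦ 1) z
    rw [transvection_one_of hzx, _root_.map_mul, ha z hzy, ha x hxy] at hu
    obtain ⟨i, j, hij⟩ := eq_zpow_mul_zpow_of_conj (y := z) (x := x)
      (g := of y ^ (a x - a z)) (h := of y ^ (-a z) * u) hε hε
      (weight_true_le_two (x := z) (y := x) hk) (by
        have : of y ^ (-a z) * u * (of z * of x) ^ k * (of y ^ (-a z) * u)⁻¹ =
          of y ^ (-a z) * (u * (of z * of x) ^ k * u⁻¹) * of y ^ a z := by group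
        rw [this, ← hu]; group)
    have := congrArg (exponentSum y) hij
    rw [_root_.map_mul, map_zpow, map_zpow, map_zpow, exponentSum_of hzy, exponentSum_of hxy,
      exponentSum_of_self, one_zpow, one_zpow, one_mul, ← zpow_zero (Multiplicative.ofAdd (1 : ℤ))]
      at this
    have := ofAdd_one_zpow_inj this
    omega
  have hall (z : X) : σ (of z) = of y ^ a x * of z ^ ε * of y ^ (-a x) := by
    rcases eq_or_ne z y with rfl | hzy
    · rw [hg]; group
    · rw [ha z hzy, hconst z hzy]
  rcases hε with rfl | rfl
  · refine ⟨of y ^ a x, ?_⟩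
    have : σ.toMonoidHom = (MulAut.conj (of y ^ a x)).toMonoidHom := by
      ext z
      simp [hall, -_root_.map_zpow]
    ext w
    exact DFunLike.congr_fun this w
  · obtain ⟨z, hz⟩ := Infinite.exists_notMem_finset {x, y}
    simp only [Finset.mem_insert, Finset.mem_singleton, not_or] at hz
    have hinv (t : X) : (MulAut.conj (of y ^ (-a x)) * σ) (of t) = (of t)⁻¹ := by
      rw [MulAut.mul_apply, hall, MulAut.conj_apply]; group
    exact absurd (hσ.conj_mul (of y ^ (-a x))) (not_preservesPrimitiveClasses_of_inv hxy
      (Ne.symm hz.1) (Ne.symm hz.2) (hinv x) (hinv y) (hinv z))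

end Conjugation

section SmallClass

/-- If the conjugacy class of `σ` has at most `#X` elements, then `σ` commutes with some
transvection along `y`. -/
theorem exists_commute_transvection [DecidableEq X] [Infinite X] {σ : MulAut (FreeGroup X)}
    (hσ : #{τ : MulAut (FreeGroup X) | IsConj σ τ} ≤ #X) (y : X) :
    ∃ x ≠ y, ∃ f : X → ℤ, f x = 1 ∧ Commute (transvection y f) σ := by
  classical
  let F (S : Set ({y}ᶜ : Set X)) (x : X) : ℤ := if ∃ h, (⟨x, h⟩ : ({y}ᶜ : Set X)) ∈ S then 1 else 0
  let Φ (S : Set ({y}ᶜ : Set X)) : {τ : MulAut (FreeGroup X) | IsConj σ τ} :=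
    ⟨transvection y (F S) * σ * (transvection y (F S))⁻¹, isConj_iff.2 ⟨_, rfl⟩⟩
  have hcard : #({y}ᶜ : Set X) = #X := by
    apply mk_compl_of_infinite
    rw [mk_singleton]
    exact one_lt_aleph0.trans_le (aleph0_le_mk X)
  have hΦ : ¬ Function.Injective Φ := fun hinj ↦ by
    have := (mk_le_of_injective hinj).trans hσ
    rw [mk_set, hcard] at this
    exact (cantor _).not_ge this
  have key {S T : Set ({y}ᶜ : Set X)} (hST : Φ S = Φ T) {x : ({y}ᶜ : Set X)} (hxS : x ∈ S)
      (hxT : x ∉ T) : ∃ x ≠ y, ∃ f : X → ℤ, f x = 1 ∧ Commute (transvection y f) σ := by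
    refine ⟨x, x.2, -F T + F S, ?_, ?_⟩
    · have hx : (x : X) ≠ y := x.2
      simp [F, hxS, hxT, hx]
    · have h := congrArg Subtype.val hST
      simp only [Φ] at h
      rw [← transvection_mul, ← transvection_inv, commute_iff_eq]
      rw [mul_inv_eq_iff_eq_mul] at h
      rw [mul_assoc, h]
      group
  rw [Function.not_injective_iff] at hΦ
  obtain ⟨S, T, hST, hne⟩ := hΦ
  obtain ⟨x, hx⟩ : ∃ x, ¬ (x ∈ S ↔ x ∈ T) := by
    by_contra! h
    exact hne (Set.ext h)
  by_cases hxS : x ∈ S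
  · exact key hST hxS fun hxT ↦ hx (by simp [hxS, hxT])
  · exact key hST.symm (x := x) (by tauto) hxS

theorem preservesPrimitiveClasses_of_mk_le [Infinite X] {σ : MulAut (FreeGroup X)}
    (hσ : #{τ : MulAut (FreeGroup X) | IsConj σ τ} ≤ #X) : PreservesPrimitiveClasses σ := by
  classical
  intro a y
  have hclass : {τ : MulAut (FreeGroup X) | IsConj σ τ} = {τ | IsConj (a⁻¹ * σ * a) τ} := by
    have : IsConj σ (a⁻¹ * σ * a) := isConj_iff.2 ⟨a⁻¹, by simp⟩
    ext τ
    exact ⟨this.symm.trans, this.trans⟩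
  rw [hclass] at hσ
  have hforall (x : X) : ∃ (k : ℤ) (h : FreeGroup X),
      (a⁻¹ * σ * a) (of x) = h * of x ^ k * h⁻¹ := by
    obtain ⟨z, hzx, f, hf, hcomm⟩ := exists_commute_transvection hσ x
    exact exists_conj_zpow_of_commute_transvection hzx hf hcomm
  choose k h hkh using hforall
  refine ⟨k y, eq_one_or_neg_one_of_forall_conj_zpow hkh y, a (h y), ?_⟩
  rw [← map_zpow, ← _root_.map_inv, ← _root_.map_mul, ← _root_.map_mul, ← hkh, ← MulAut.mul_apply,
    ← MulAut.mul_apply]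
  congr 1
  group

end SmallClass

end FreeGroup

/-- An automorphism `σ` of a free group `F = FreeGroup X` of infinite rank has small
conjugacy class in `Aut F` (of cardinality at most `#X`) iff `σ` is an inner
automorphism of `F`. -/
theorem small_conjugacy_class_iff_inner
    {X : Type*} [Infinite X] (σ : MulAut (FreeGroup X)) :
    Cardinal.mk {τ : MulAut (FreeGroup X) | IsConj σ τ} ≤ Cardinal.mk X ↔
      ∃ g : FreeGroup X, ∀ h : FreeGroup X, σ h = g * h * g⁻¹ := by
  classical
  constructor
  · intro hσ
    obtain ⟨g, rfl⟩ := (FreeGroup.preservesPrimitiveClasses_of_mk_le hσ).exists_eq_conj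
    exact ⟨g, fun h ↦ MulAut.conj_apply g h⟩
  · rintro ⟨g, hg⟩
    have hsub : {τ : MulAut (FreeGroup X) | IsConj σ τ} ⊆
        Set.range (MulAut.conj : FreeGroup X →* MulAut (FreeGroup X)) := by
      intro τ hτ
      obtain ⟨a, rfl⟩ := isConj_iff.1 hτ
      refine ⟨a g, ?_⟩
      ext w
      simp [hg]
    calc #{τ : MulAut (FreeGroup X) | IsConj σ τ}
        ≤ #(Set.range (MulAut.conj : FreeGroup X →* MulAut (FreeGroup X))) :=
          mk_le_mk_of_subset hsub
      _ ≤ #(FreeGroup X) := mk_range_le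
      _ = #X := by rw [mk_freeGroup, max_eq_left (aleph0_le_mk X)]
end

section
/- Let F = FreeGroup X with X an infinite type, and let R be a fully invariant subgroup of F such that the quotient group F/R is nontrivial and torsion-free, all units of the integral group ring ℤ[F/R] are trivial (every unit equals ε·ḡ for some ḡ ∈ F/R and ε ∈ {1,−1}), and every automorphism of G = F ⧸ ⁅R,R⁆ that fixes the image R̂ of R pointwise is an inner automorphism of G determined by an element of R̂. Then the group Aut G is complete: its center is trivial and every automorphism of Aut G is inner. -/
section GroupRing

variable {Q : Type*} [Group Q]

/-- The anti-involution of the integral group ring inverting group elements. -/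
noncomputable def groupRingInv (a : MonoidAlgebra ℤ Q) : MonoidAlgebra ℤ Q :=
  a.mapDomain (·⁻¹)

theorem groupRingInv_mul (a b : MonoidAlgebra ℤ Q) :
    groupRingInv (a * b) = groupRingInv b * groupRingInv a := by
  unfold groupRingInv
  induction a using MonoidAlgebra.induction_linear with
  | zero => simp
  | add a a' ha ha' => rw [add_mul, MonoidAlgebra.mapDomain_add, MonoidAlgebra.mapDomain_add,
      mul_add, ha, ha']
  | single g r =>
    induction b using MonoidAlgebra.induction_linear with
    | zero => simp
    | add b b' hb hb' => rw [mul_add, MonoidAlgebra.mapDomain_add, MonoidAlgebra.mapDomain_add,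
        add_mul, hb, hb']
    | single h s => simp [MonoidAlgebra.single_mul_single, mul_comm]

theorem groupRingInv_groupRingInv (a : MonoidAlgebra ℤ Q) :
    groupRingInv (groupRingInv a) = a := by
  unfold groupRingInv
  induction a using MonoidAlgebra.induction_linear with
  | zero => simp
  | add a a' ha ha' => rw [MonoidAlgebra.mapDomain_add, MonoidAlgebra.mapDomain_add, ha, ha']
  | single g r => simp

theorem coeff_groupRingInv (a : MonoidAlgebra ℤ Q) (g : Q) :
    (groupRingInv a).coeff g⁻¹ = a.coeff g := by
  unfold groupRingInv
  exact Finsupp.mapDomain_apply inv_injective a.coeff g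

theorem eq_zero_of_mul_groupRingInv_eq_zero {a : MonoidAlgebra ℤ Q}
    (h : a * groupRingInv a = 0) : a = 0 := by
  have h1 : (a * groupRingInv a).coeff 1 = 0 := by rw [h]; rfl
  rw [MonoidAlgebra.coeff_mul_apply_left, Finsupp.sum] at h1
  simp only [mul_one, coeff_groupRingInv] at h1
  rw [Finset.sum_eq_zero_iff_of_nonneg fun g _ => mul_self_nonneg _] at h1
  rw [← MonoidAlgebra.coeff_eq_zero]
  ext g
  by_contra hg
  exact hg (mul_self_eq_zero.1 (h1 g (Finsupp.mem_support_iff.2 hg)))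

/-- The integral group ring of a group is semiprime. -/
theorem groupRing_semiprime {a : MonoidAlgebra ℤ Q}
    (h : ∀ g : Q, a * MonoidAlgebra.of ℤ Q g * a = 0) : a = 0 := by
  have h' : ∀ b : MonoidAlgebra ℤ Q, a * b * a = 0 := by
    intro b
    induction b using MonoidAlgebra.induction_on with
    | of g => exact h g
    | add b c hb hc => rw [mul_add, add_mul, hb, hc, add_zero]
    | smul n b hb => rw [mul_smul_comm, smul_mul_assoc, hb, smul_zero]
  apply eq_zero_of_mul_groupRingInv_eq_zero
  apply eq_zero_of_mul_groupRingInv_eq_zero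
  rw [groupRingInv_mul, groupRingInv_groupRingInv, ← mul_assoc, h', zero_mul]

/-- In the integral group ring modulo `n`, the element `h - 1` is not a zero divisor when `h`
has infinite order. -/
theorem dvd_coeff_of_dvd_sub {h : Q} (hh : ∀ k : ℕ, k ≠ 0 → h ^ k ≠ 1) {n : ℤ}
    {a : MonoidAlgebra ℤ Q}
    (ha : ∀ g, n ∣ (MonoidAlgebra.of ℤ Q h * a - a).coeff g) (g : Q) : n ∣ a.coeff g := by
  have step : ∀ g, n ∣ a.coeff (h⁻¹ * g) - a.coeff g := by
    intro g
    have := ha g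
    rwa [MonoidAlgebra.coeff_sub, Finsupp.sub_apply, MonoidAlgebra.of_apply,
      MonoidAlgebra.coeff_single_mul_apply, one_mul] at this
  have steps : ∀ k : ℕ, n ∣ a.coeff ((h⁻¹) ^ k * g) - a.coeff g := by
    intro k
    induction k with
    | zero => simp
    | succ k ih =>
      have := dvd_add (step ((h⁻¹) ^ k * g)) ih
      rwa [sub_add_sub_cancel, ← mul_assoc, ← pow_succ'] at this
  have hinj : Function.Injective fun k : ℕ => (h⁻¹) ^ k * g := by
    have : Function.Injective fun k : ℕ => h ^ k := by
      apply injective_pow_iff_not_isOfFinOrder.2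
      rw [isOfFinOrder_iff_pow_eq_one]
      rintro ⟨k, hk, hk'⟩
      exact hh k hk.ne' hk'
    intro i j hij
    apply this
    simpa using hij
  obtain ⟨k, hk⟩ : ∃ k : ℕ, (h⁻¹) ^ k * g ∉ a.coeff.support := by
    by_contra! hall
    exact (Set.infinite_range_of_injective hinj)
      (a.coeff.support.finite_toSet.subset (by rintro _ ⟨k, rfl⟩; exact hall k))
  have := steps k
  rw [Finsupp.notMem_support_iff.1 hk, zero_sub, dvd_neg] at this
  exact this

end GroupRing

/-- An extension `proj : G → Q` of groups, generated by a family `gen` for which every assignment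
of values to the generators extends to an endomorphism of `G`, together with a Magnus embedding
`fox` of `G`, given by Fox derivatives. The Fox derivatives embed the kernel of `proj` into a free
`ℤ[Q]`-module. -/
structure MagnusExtension (X G Q : Type*) [Group G] [Group Q] where
  /-- The projection. -/
  proj : G →* Q
  /-- The generators. -/
  gen : X → G
  /-- The Fox derivatives. -/
  fox : G → X →₀ MonoidAlgebra ℤ Q
  proj_surjective : Function.Surjective proj
  fox_mul : ∀ g h, fox (g * h) = fox g + MonoidAlgebra.of ℤ Q (proj g) • fox h
  fox_gen : ∀ x, fox (gen x) = Finsupp.single x 1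
  exists_hom : ∀ v : X → G, ∃ θ : G →* G, ∀ x, θ (gen x) = v x
  closure_gen : Subgroup.closure (Set.range gen) = ⊤
  proj_hom : ∀ (θ : G →* G) (g : G), proj g = 1 → proj (θ g) = 1
  eq_one_of_fox_eq_zero : ∀ g, proj g = 1 → fox g = 0 → g = 1
  exists_sq : ∀ g m, proj g = 1 → fox g = (2 : ℤ) • m → ∃ r, proj r = 1 ∧ g = r ^ 2
  proj_gen_ne_one : ∀ x, proj (gen x) ≠ 1
  torsionFree : ∀ g : Q, g ≠ 1 → ∀ n : ℕ, n ≠ 0 → g ^ n ≠ 1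

namespace MagnusExtension

variable {X G Q : Type*} [Group G] [Group Q] (E : MagnusExtension X G Q)

/-- The endomorphism of `Q` induced by an endomorphism of `G`. -/
noncomputable def induced (θ : G →* G) : Q →* Q :=
  E.proj.liftOfSurjective E.proj_surjective
    ⟨E.proj.comp θ, fun g hg => E.proj_hom θ g hg⟩

@[simp] theorem induced_proj (θ : G →* G) (g : G) : E.induced θ (E.proj g) = E.proj (θ g) :=
  E.proj.liftOfRightInverse_comp_apply _ _ ⟨E.proj.comp θ, _⟩ g

/-- The endomorphism of `ℤ[Q]` induced by an endomorphism of `G`. -/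
noncomputable def inducedRing (θ : G →* G) : MonoidAlgebra ℤ Q →+* MonoidAlgebra ℤ Q :=
  MonoidAlgebra.mapDomainRingHom ℤ (E.induced θ)

@[simp] theorem inducedRing_of (θ : G →* G) (g : G) :
    E.inducedRing θ (MonoidAlgebra.of ℤ Q (E.proj g)) =
      MonoidAlgebra.of ℤ Q (E.proj (θ g)) := by
  simp [inducedRing]

theorem groupRing_induction {p : MonoidAlgebra ℤ Q → Prop} (a : MonoidAlgebra ℤ Q)
    (of : ∀ g, p (MonoidAlgebra.of ℤ Q (E.proj g))) (zero : p 0)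
    (add : ∀ a b, p a → p b → p (a + b)) (neg : ∀ a, p a → p (-a)) : p a := by
  induction a using MonoidAlgebra.induction_on with
  | of q =>
    obtain ⟨g, rfl⟩ := E.proj_surjective q
    exact of g
  | add a b ha hb => exact add a b ha hb
  | smul n a ha =>
    induction n using Int.induction_on with
    | zero => simpa using zero
    | succ n ih => rw [add_smul, one_smul]; exact add _ _ ih ha
    | pred n ih => rw [sub_smul, one_smul, sub_eq_add_neg]; exact add _ _ ih (neg _ ha)

theorem induction_gen {p : G → Prop} (g : G) (gen : ∀ x, p (E.gen x)) (one : p 1)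
    (mul : ∀ g h, p g → p h → p (g * h)) (inv : ∀ g, p g → p g⁻¹) : p g := by
  have hg : g ∈ Subgroup.closure (Set.range E.gen) := E.closure_gen ▸ Subgroup.mem_top g
  induction hg using Subgroup.closure_induction with
  | mem g hg => obtain ⟨x, rfl⟩ := hg; exact gen x
  | one => exact one
  | mul g h _ _ hg hh => exact mul g h hg hh
  | inv g _ hg => exact inv g hg

theorem hom_ext {H : Type*} [Group H] {θ₁ θ₂ : G →* H}
    (h : ∀ x, θ₁ (E.gen x) = θ₂ (E.gen x)) : θ₁ = θ₂ :=
  MonoidHom.eq_of_eqOn_dense E.closure_gen (by rintro _ ⟨x, rfl⟩; exact h x)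

@[simp] theorem fox_one : E.fox 1 = 0 := by
  have := E.fox_mul 1 1
  rw [mul_one, map_one, map_one, one_smul] at this
  simpa using this

theorem fox_mul_of_proj_eq_one {g : G} (hg : E.proj g = 1) (h : G) :
    E.fox (g * h) = E.fox g + E.fox h := by
  rw [E.fox_mul, hg, map_one, one_smul]

theorem of_smul_fox_inv (g : G) :
    MonoidAlgebra.of ℤ Q (E.proj g) • E.fox g⁻¹ = -E.fox g := by
  have := E.fox_mul g g⁻¹
  rw [mul_inv_cancel, fox_one] at this
  exact (neg_eq_of_add_eq_zero_right this.symm).symm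

theorem fox_inv (g : G) :
    E.fox g⁻¹ = -(MonoidAlgebra.of ℤ Q (E.proj g⁻¹) • E.fox g) := by
  rw [← smul_neg, ← E.of_smul_fox_inv, smul_smul, ← map_mul, ← map_mul, inv_mul_cancel,
    map_one, map_one, one_smul]

theorem fox_inv_of_proj_eq_one {g : G} (hg : E.proj g = 1) : E.fox g⁻¹ = -E.fox g := by
  rw [fox_inv, map_inv, hg, inv_one, map_one, one_smul]

theorem fox_conj {r : G} (hr : E.proj r = 1) (g : G) :
    E.fox (g * r * g⁻¹) = MonoidAlgebra.of ℤ Q (E.proj g) • E.fox r := by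
  rw [E.fox_mul, E.fox_mul, map_mul, hr, mul_one, of_smul_fox_inv]
  abel

theorem proj_conj {r : G} (hr : E.proj r = 1) (g : G) : E.proj (g * r * g⁻¹) = 1 := by
  simp [hr]

theorem eq_of_fox_eq {r s : G} (hr : E.proj r = 1) (hs : E.proj s = 1)
    (h : E.fox r = E.fox s) : r = s := by
  rw [← mul_inv_eq_one]
  apply E.eq_one_of_fox_eq_zero
  · simp [hr, hs]
  · rw [E.fox_mul_of_proj_eq_one hr, E.fox_inv_of_proj_eq_one hs, h, add_neg_cancel]

theorem commute_of_proj_eq_one {r s : G} (hr : E.proj r = 1) (hs : E.proj s = 1) :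
    Commute r s := by
  apply E.eq_of_fox_eq
  · simp [hr, hs]
  · simp [hr, hs]
  · rw [E.fox_mul_of_proj_eq_one hr, E.fox_mul_of_proj_eq_one hs, add_comm]

/-- Endomorphisms act semilinearly on the kernel of the projection. -/
theorem fox_hom_of_fox_eq_smul (θ : G →* G) {e d : G} (he : E.proj e = 1) (hd : E.proj d = 1)
    {a : MonoidAlgebra ℤ Q} (h : E.fox e = a • E.fox d) :
    E.fox (θ e) = E.inducedRing θ a • E.fox (θ d) := by
  obtain ⟨e', he', h', h''⟩ : ∃ e', E.proj e' = 1 ∧ E.fox e' = a • E.fox d ∧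
      E.fox (θ e') = E.inducedRing θ a • E.fox (θ d) := by
    clear h
    induction a using E.groupRing_induction with
    | of g =>
      refine ⟨g * d * g⁻¹, E.proj_conj hd g, E.fox_conj hd g, ?_⟩
      rw [inducedRing_of, map_mul, map_mul, map_inv, E.fox_conj (E.proj_hom θ d hd)]
    | zero => exact ⟨1, by simp, by simp, by simp⟩
    | add a b ha hb =>
      obtain ⟨e₁, h₁, h₁', h₁''⟩ := ha
      obtain ⟨e₂, h₂, h₂', h₂''⟩ := hb
      refine ⟨e₁ * e₂, by simp [h₁, h₂], ?_, ?_⟩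
      · rw [E.fox_mul_of_proj_eq_one h₁, h₁', h₂', add_smul]
      · rw [map_mul, E.fox_mul_of_proj_eq_one (E.proj_hom θ _ h₁), h₁'', h₂'', map_add, add_smul]
    | neg a ha =>
      obtain ⟨e₁, h₁, h₁', h₁''⟩ := ha
      refine ⟨e₁⁻¹, by simp [h₁], ?_, ?_⟩
      · rw [E.fox_inv_of_proj_eq_one h₁, h₁', neg_smul]
      · rw [map_inv, E.fox_inv_of_proj_eq_one (E.proj_hom θ _ h₁), h₁'', map_neg, neg_smul]
  rw [E.eq_of_fox_eq he he' (h.trans h'.symm), h'']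

/-- Every element involves only finitely many generators. -/
theorem exists_finset_hom_eq (g : G) :
    ∃ S : Finset X, ∀ θ₁ θ₂ : G →* G, (∀ x ∈ S, θ₁ (E.gen x) = θ₂ (E.gen x)) → θ₁ g = θ₂ g := by
  classical
  induction g using E.induction_gen with
  | gen x => exact ⟨{x}, fun _ _ h => h x (Finset.mem_singleton_self x)⟩
  | one => exact ⟨∅, fun _ _ _ => by simp⟩
  | mul g h hg hh =>
    obtain ⟨S, hS⟩ := hg
    obtain ⟨T, hT⟩ := hh
    refine ⟨S ∪ T, fun θ₁ θ₂ h => ?_⟩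
    rw [map_mul, map_mul, hS θ₁ θ₂ fun x hx => h x (Finset.mem_union_left _ hx),
      hT θ₁ θ₂ fun x hx => h x (Finset.mem_union_right _ hx)]
  | inv g hg =>
    obtain ⟨S, hS⟩ := hg
    exact ⟨S, fun θ₁ θ₂ h => by rw [map_inv, map_inv, hS θ₁ θ₂ h]⟩

/-- Every group ring element involves only finitely many generators. -/
theorem exists_finset_inducedRing_eq (a : MonoidAlgebra ℤ Q) :
    ∃ S : Finset X, ∀ θ₁ θ₂ : G →* G, (∀ x ∈ S, θ₁ (E.gen x) = θ₂ (E.gen x)) →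
      E.inducedRing θ₁ a = E.inducedRing θ₂ a := by
  classical
  induction a using E.groupRing_induction with
  | of g =>
    obtain ⟨S, hS⟩ := E.exists_finset_hom_eq g
    exact ⟨S, fun θ₁ θ₂ h => by rw [inducedRing_of, inducedRing_of, hS θ₁ θ₂ h]⟩
  | zero => exact ⟨∅, fun _ _ _ => by simp⟩
  | add a b ha hb =>
    obtain ⟨S, hS⟩ := ha
    obtain ⟨T, hT⟩ := hb
    refine ⟨S ∪ T, fun θ₁ θ₂ h => ?_⟩
    rw [map_add, map_add, hS θ₁ θ₂ fun x hx => h x (Finset.mem_union_left _ hx),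
      hT θ₁ θ₂ fun x hx => h x (Finset.mem_union_right _ hx)]
  | neg a ha =>
    obtain ⟨S, hS⟩ := ha
    exact ⟨S, fun θ₁ θ₂ h => by rw [map_neg, map_neg, hS θ₁ θ₂ h]⟩

theorem inducedRing_eq_self {θ : G →* G} (hθ : ∀ g, E.proj (θ g) = E.proj g)
    (a : MonoidAlgebra ℤ Q) : E.inducedRing θ a = a := by
  induction a using E.groupRing_induction with
  | of g => rw [inducedRing_of, hθ]
  | zero => simp
  | add a b ha hb => rw [map_add, ha, hb]
  | neg a ha => rw [map_neg, ha]

@[simp] theorem inducedRing_id (a : MonoidAlgebra ℤ Q) :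
    E.inducedRing (MonoidHom.id G) a = a :=
  E.inducedRing_eq_self (fun _ => rfl) a

theorem inducedRing_comp (θ₁ θ₂ : G →* G) (a : MonoidAlgebra ℤ Q) :
    E.inducedRing (θ₁.comp θ₂) a = E.inducedRing θ₁ (E.inducedRing θ₂ a) := by
  induction a using E.groupRing_induction with
  | of g => simp only [inducedRing_of, MonoidHom.comp_apply]
  | zero => simp
  | add a b ha hb => simp only [map_add, ha, hb]
  | neg a ha => simp only [map_neg, ha]

/-- The chain rule for a renaming of the generators. -/
theorem fox_hom_gen_apply {f : X → X} (hf : Function.Injective f) {θ : G →* G}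
    (hθ : ∀ x, θ (E.gen x) = E.gen (f x)) (g : G) (x : X) :
    E.fox (θ g) (f x) = E.inducedRing θ (E.fox g x) := by
  classical
  induction g using E.induction_gen with
  | gen y =>
    rw [hθ, fox_gen, fox_gen, Finsupp.single_apply, Finsupp.single_apply, hf.eq_iff]
    split_ifs <;> simp
  | one => simp
  | mul g h hg hh =>
    simp only [map_mul, fox_mul, Finsupp.add_apply, Finsupp.smul_apply, smul_eq_mul, map_add,
      hg, hh, inducedRing_of]
  | inv g hg =>
    rw [map_inv, fox_inv, fox_inv, Finsupp.neg_apply, Finsupp.neg_apply, Finsupp.smul_apply,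
      Finsupp.smul_apply, hg, map_neg, smul_eq_mul, smul_eq_mul, map_mul, inducedRing_of,
      map_inv θ]

/-- The fundamental formula of the Fox calculus. -/
theorem linearCombination_fox (g : G) :
    Finsupp.linearCombination (MonoidAlgebra ℤ Q)
      (fun x => MonoidAlgebra.of ℤ Q (E.proj (E.gen x)) - 1) (E.fox g) =
        MonoidAlgebra.of ℤ Q (E.proj g) - 1 := by
  induction g using E.induction_gen with
  | gen x => rw [fox_gen, Finsupp.linearCombination_single, one_smul]
  | one => rw [fox_one, map_zero, map_one, map_one, sub_self]
  | mul g h hg hh =>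
    rw [fox_mul, map_add, map_smul, hg, hh, map_mul, map_mul, smul_eq_mul]
    noncomm_ring
  | inv g hg =>
    rw [fox_inv, map_neg, map_smul, hg, smul_eq_mul, mul_sub, ← map_mul, ← map_mul,
      inv_mul_cancel, mul_one, map_one, map_one, neg_sub]

include E in
theorem fox_eq_zero_of_smul_eq {q : Q} (hq : q ≠ 1) {m : X →₀ MonoidAlgebra ℤ Q}
    (h : MonoidAlgebra.of ℤ Q q • m = m) : m = 0 := by
  ext x g
  have := dvd_coeff_of_dvd_sub (E.torsionFree q hq) (n := 0) (a := m x) (fun g => by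
    have := DFunLike.congr_fun h x
    rw [Finsupp.smul_apply, smul_eq_mul] at this
    rw [this, sub_self]
    exact dvd_zero _) g
  simpa using this

/-- An element of the kernel commuting with an element outside the kernel is trivial. -/
theorem eq_one_of_conj_eq {g r : G} (hr : E.proj r = 1) (hg : E.proj g ≠ 1)
    (h : g * r * g⁻¹ = r) : r = 1 := by
  apply E.eq_one_of_fox_eq_zero r hr
  apply fox_eq_zero_of_smul_eq E hg
  rw [← E.fox_conj hr, h]

theorem proj_eq_one_of_conj_eq {g r : G} (hr : E.proj r = 1) (hr' : r ≠ 1)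
    (h : g * r * g⁻¹ = r) : E.proj g = 1 := by
  by_contra hg
  exact hr' (E.eq_one_of_conj_eq hr hg h)

theorem proj_mulAut (φ : MulAut G) {g : G} (hg : E.proj g = 1) : E.proj (φ g) = 1 :=
  E.proj_hom φ.toMonoidHom g hg

theorem proj_mulAut_iff (φ : MulAut G) {g : G} : E.proj (φ g) = 1 ↔ E.proj g = 1 := by
  refine ⟨fun h => ?_, E.proj_mulAut φ⟩
  simpa using E.proj_mulAut φ⁻¹ h

theorem eq_one_of_central [Nonempty X] (hker : ∃ r, E.proj r = 1 ∧ r ≠ 1) {z : G}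
    (hz : ∀ g, g * z * g⁻¹ = z) : z = 1 := by
  obtain ⟨r, hr, hr'⟩ := hker
  obtain ⟨x⟩ := ‹Nonempty X›
  refine E.eq_one_of_conj_eq (E.proj_eq_one_of_conj_eq hr hr' ?_) (E.proj_gen_ne_one x) (hz _)
  have := hz r
  rw [mul_inv_eq_iff_eq_mul] at this ⊢
  exact this.symm

theorem conj_injective [Nonempty X] (hker : ∃ r, E.proj r = 1 ∧ r ≠ 1) :
    Function.Injective (MulAut.conj : G →* MulAut G) := by
  rw [injective_iff_map_eq_one]
  intro z hz
  apply E.eq_one_of_central hker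
  intro g
  have := DFunLike.congr_fun hz g
  rw [MulAut.conj_apply, MulAut.one_apply, mul_inv_eq_iff_eq_mul] at this
  rw [mul_inv_eq_iff_eq_mul, this]

theorem mul_conj_mul_inv (φ : MulAut G) (g : G) :
    φ * MulAut.conj g * φ⁻¹ = MulAut.conj (φ g) := by
  ext h
  simp [MulAut.mul_apply]

/-- The generator `z` does not occur in `g`. -/
def Avoids (z : X) (g : G) : Prop :=
  ∀ θ : G →* G, (∀ x, x ≠ z → θ (E.gen x) = E.gen x) → θ g = g

theorem exists_finset_avoids (g : G) : ∃ S : Finset X, ∀ z ∉ S, E.Avoids z g := by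
  obtain ⟨S, hS⟩ := E.exists_finset_hom_eq g
  refine ⟨S, fun z hz θ hθ => hS θ (MonoidHom.id G) fun x hx => ?_⟩
  exact hθ x (by rintro rfl; exact hz hx)

theorem exists_mulAut {v w : X → G} (h : ∀ θ₁ θ₂ : G →* G, (∀ x, θ₁ (E.gen x) = v x) →
    (∀ x, θ₂ (E.gen x) = w x) → (∀ x, θ₁ (w x) = E.gen x) ∧ ∀ x, θ₂ (v x) = E.gen x) :
    ∃ ψ : MulAut G, ∀ x, ψ (E.gen x) = v x := by
  obtain ⟨θ₁, h₁⟩ := E.exists_hom v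
  obtain ⟨θ₂, h₂⟩ := E.exists_hom w
  obtain ⟨h₁₂, h₂₁⟩ := h θ₁ θ₂ h₁ h₂
  refine ⟨MonoidHom.toMulEquiv θ₁ θ₂ ?_ ?_, h₁⟩
  · exact E.hom_ext fun x => by simp [h₁, h₂₁]
  · exact E.hom_ext fun x => by simp [h₂, h₁₂]

theorem exists_mulAut_perm (π : Equiv.Perm X) :
    ∃ ψ : MulAut G, ∀ x, ψ (E.gen x) = E.gen (π x) :=
  E.exists_mulAut (w := fun x => E.gen (π.symm x)) fun θ₁ θ₂ h₁ h₂ => by simp [h₁, h₂]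

/-- The transvection `z ↦ d * z`. -/
theorem exists_transvection {z : X} {d : G} (hd : E.Avoids z d) :
    ∃ t : MulAut G, t (E.gen z) = d * E.gen z ∧ ∀ x, x ≠ z → t (E.gen x) = E.gen x := by
  classical
  obtain ⟨t, ht⟩ := E.exists_mulAut (v := fun x => if x = z then d * E.gen z else E.gen x)
    (w := fun x => if x = z then d⁻¹ * E.gen z else E.gen x) (fun θ₁ θ₂ h₁ h₂ => by
      have hd₁ := hd θ₁ fun x hx => by rw [h₁, if_neg hx]
      have hd₂ := hd θ₂ fun x hx => by rw [h₂, if_neg hx]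
      constructor
      · intro x
        by_cases hx : x = z
        · simp [hx, h₁, hd₁]
        · simp [hx, h₁]
      · intro x
        by_cases hx : x = z
        · simp [hx, h₂, hd₂]
        · simp [hx, h₂])
  exact ⟨t, by simp [ht], fun x hx => by simp [ht, hx]⟩

section Transvection

variable {E} {z : X} {d : G} {t : G →* G} (hd : E.proj d = 1)
  (htz : t (E.gen z) = d * E.gen z) (ht : ∀ x, x ≠ z → t (E.gen x) = E.gen x)

include hd htz ht in
theorem proj_transvection (g : G) : E.proj (t g) = E.proj g := by
  have : E.proj.comp t = E.proj := E.hom_ext fun x => by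
    by_cases hx : x = z
    · simp [hx, htz, hd]
    · simp [ht x hx]
  exact DFunLike.congr_fun this g

include hd htz ht in
theorem fox_transvection (g : G) : E.fox (t g) = E.fox g + E.fox g z • E.fox d := by
  classical
  induction g using E.induction_gen with
  | gen x =>
    by_cases hx : x = z
    · rw [hx, htz, E.fox_mul_of_proj_eq_one hd, E.fox_gen, Finsupp.single_eq_same, one_smul,
        add_comm]
    · rw [ht x hx, E.fox_gen, Finsupp.single_apply, if_neg hx, zero_smul, add_zero]
  | one => simp
  | mul g h hg hh =>
    rw [map_mul, fox_mul, fox_mul, hg, hh, proj_transvection hd htz ht, Finsupp.add_apply,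
      Finsupp.smul_apply, add_smul, smul_add, smul_smul, smul_eq_mul]
    abel
  | inv g hg =>
    rw [map_inv, fox_inv, fox_inv, hg, map_inv E.proj, proj_transvection hd htz ht,
      map_inv E.proj, Finsupp.neg_apply, Finsupp.smul_apply, neg_smul, smul_add, smul_smul,
      smul_eq_mul]
    abel

end Transvection

/-- If `φ` commutes with all of its conjugates, then `φ` fixes all images of `φ g * g⁻¹`. -/
theorem apply_apply_mul_inv_eq [Nonempty X] (hker : ∃ r, E.proj r = 1 ∧ r ≠ 1) {φ : MulAut G}
    (hφ : ∀ ψ : MulAut G, Commute φ (ψ * φ * ψ⁻¹)) (ψ : MulAut G) (g : G) :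
    φ (ψ (φ g * g⁻¹)) = ψ (φ g * g⁻¹) := by
  have h₁ : MulAut.conj (ψ (φ g * g⁻¹)) =
      ψ * φ * ψ⁻¹ * ((ψ * MulAut.conj g) * φ * (ψ * MulAut.conj g)⁻¹)⁻¹ := by
    rw [← mul_conj_mul_inv, map_mul, map_inv, ← mul_conj_mul_inv]
    group
  have h₂ : Commute φ (MulAut.conj (ψ (φ g * g⁻¹))) := by
    rw [h₁]
    exact (hφ ψ).mul_right (hφ _).inv_right
  apply E.conj_injective hker
  rw [← mul_conj_mul_inv, h₂.eq, mul_inv_cancel_right]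

/-- An automorphism commuting with all of its conjugates fixes the kernel pointwise. -/
theorem apply_eq_of_commute_conj [Infinite X] {φ : MulAut G}
    (hφ : ∀ ψ : MulAut G, Commute φ (ψ * φ * ψ⁻¹)) {d : G} (hd : E.proj d = 1) : φ d = d := by
  classical
  by_contra hne
  have hd1 : d ≠ 1 := by rintro rfl; exact hne (map_one φ)
  have hstar := E.apply_apply_mul_inv_eq ⟨d, hd, hd1⟩ hφ
  set s := φ d * d⁻¹ with hs
  have hs1 : s ≠ 1 := by rwa [hs, Ne, mul_inv_eq_one]
  have hps : E.proj s = 1 := by rw [hs, map_mul, E.proj_mulAut φ hd, map_inv, hd]; simp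
  have hφs : φ s = s := hstar 1 d
  have hproj : ∀ g, E.proj (φ g) = E.proj g := by
    intro g
    have h := hstar (MulAut.conj g) d
    rw [← hs, MulAut.conj_apply, map_mul, map_mul, map_inv, hφs] at h
    have : E.proj (g⁻¹ * φ g) = 1 := by
      apply E.proj_eq_one_of_conj_eq hps hs1
      calc g⁻¹ * φ g * s * (g⁻¹ * φ g)⁻¹ = g⁻¹ * (φ g * s * (φ g)⁻¹) * g := by group
        _ = s := by rw [h]; group
    rw [map_mul, map_inv, inv_mul_eq_one] at this
    exact this.symm
  apply hs1
  apply E.eq_one_of_fox_eq_zero s hps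
  ext1 y
  apply groupRing_semiprime
  intro q
  obtain ⟨c, rfl⟩ := E.proj_surjective q
  obtain ⟨S₁, hS₁⟩ := E.exists_finset_avoids (c * d * c⁻¹)
  obtain ⟨S₂, hS₂⟩ := E.exists_finset_inducedRing_eq (E.fox s y)
  obtain ⟨S₃, hS₃⟩ := E.exists_finset_inducedRing_eq (MonoidAlgebra.of ℤ Q (E.proj c))
  obtain ⟨z, hz⟩ := Infinite.exists_notMem_finset (S₁ ∪ S₂ ∪ S₃)
  simp only [Finset.mem_union, not_or] at hz
  obtain ⟨⟨hz₁, hz₂⟩, hz₃⟩ := hz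
  have hd' : E.proj (c * d * c⁻¹) = 1 := E.proj_conj hd c
  obtain ⟨t, htz, ht⟩ := E.exists_transvection (hS₁ z hz₁)
  obtain ⟨π, hπ⟩ := E.exists_mulAut_perm (Equiv.swap y z)
  obtain ⟨ρ, hρ⟩ := E.exists_hom fun x => if x = z then E.gen y else E.gen x
  have hπs : E.proj (π s) = 1 := E.proj_mulAut π hps
  have hfix₁ : φ (π s) = π s := hstar π d
  have hfix₂ : φ (t (π s)) = t (π s) := hstar (t * π) d
  have hfoxt := fox_transvection (t := t.toMonoidHom) hd' htz ht (π s)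
  set e := t (π s) * (π s)⁻¹ with he
  have hpe : E.proj e = 1 := by rw [he, map_mul, E.proj_mulAut t hπs, map_inv, hπs]; simp
  have hfe : E.fox e = E.fox (π s) z • E.fox (c * d * c⁻¹) := by
    rw [he, E.fox_mul_of_proj_eq_one (E.proj_mulAut t hπs), E.fox_inv_of_proj_eq_one hπs]
    erw [hfoxt]
    abel
  have hφe : φ e = e := by rw [he, map_mul, map_inv, hfix₁, hfix₂]
  have h₁ := E.fox_hom_of_fox_eq_smul φ.toMonoidHom hpe hd' hfe
  rw [E.inducedRing_eq_self (θ := φ.toMonoidHom) hproj] at h₁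
  change E.fox (φ e) = E.fox (π s) z • E.fox (φ (c * d * c⁻¹)) at h₁
  rw [hφe, hfe] at h₁
  have h₂ : φ (c * d * c⁻¹) * (c * d * c⁻¹)⁻¹ =
      φ c * s * (φ c)⁻¹ * ((φ c * d * (φ c)⁻¹) * (c * d * c⁻¹)⁻¹) := by
    rw [hs]; simp only [map_mul, map_inv]; group
  have h₃ : φ c * d * (φ c)⁻¹ = c * d * c⁻¹ := by
    apply E.eq_of_fox_eq (E.proj_conj hd _) (E.proj_conj hd _)
    rw [E.fox_conj hd, E.fox_conj hd, hproj]
  rw [h₃, mul_inv_cancel, mul_one] at h₂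
  have h₄ : E.fox (π s) z • MonoidAlgebra.of ℤ Q (E.proj c) • E.fox s = 0 := by
    rw [← hproj c, ← E.fox_conj hps, ← h₂, E.fox_mul_of_proj_eq_one (E.proj_mulAut φ hd'),
      E.fox_inv_of_proj_eq_one hd', smul_add, smul_neg, ← h₁, add_neg_cancel]
  have h₅ : E.fox (π s) z = E.inducedRing π.toMonoidHom (E.fox s y) := by
    have := E.fox_hom_gen_apply (Equiv.swap y z).injective (θ := π.toMonoidHom) hπ s y
    rwa [Equiv.swap_apply_left] at this
  have h₆ : E.inducedRing ρ (E.fox (π s) z) = E.fox s y := by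
    rw [h₅, ← inducedRing_comp]
    refine (hS₂ _ (MonoidHom.id G) fun x hx => ?_).trans (E.inducedRing_id _)
    have hxz : x ≠ z := by rintro rfl; exact hz₂ hx
    change ρ (π (E.gen x)) = E.gen x
    rw [hπ, hρ]
    by_cases hxy : x = y
    · subst hxy; simp
    · rw [Equiv.swap_apply_of_ne_of_ne hxy hxz, if_neg hxz]
  have hρid : ∀ x, x ≠ z → ρ (E.gen x) = E.gen x := fun x hx => by rw [hρ, if_neg hx]
  have h₇ := congrArg (E.inducedRing ρ) (DFunLike.congr_fun h₄ y)
  simp only [Finsupp.smul_apply, smul_eq_mul, map_mul, h₆, Finsupp.zero_apply, map_zero] at h₇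
  rw [hS₂ ρ (MonoidHom.id G) fun x hx => hρid x (by rintro rfl; exact hz₂ hx),
    hS₃ ρ (MonoidHom.id G) fun x hx => hρid x (by rintro rfl; exact hz₃ hx),
    inducedRing_id, inducedRing_id, ← mul_assoc] at h₇
  exact h₇

theorem exists_eq_two_smul {m : X →₀ MonoidAlgebra ℤ Q} (h : ∀ x g, 2 ∣ (m x).coeff g) :
    ∃ m', m = (2 : ℤ) • m' := by
  refine ⟨m.mapRange (fun a => .ofCoeff (a.coeff.mapRange (· / 2) (Int.zero_ediv 2)))
    (MonoidAlgebra.coeff_injective (Finsupp.ext fun _ => Int.zero_ediv 2)), ?_⟩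
  ext x g
  rw [Finsupp.smul_apply, MonoidAlgebra.coeff_smul, Finsupp.smul_apply]
  exact (Int.mul_ediv_cancel' (h x g)).symm

theorem two_smul_injective {m m' : X →₀ MonoidAlgebra ℤ Q} (h : (2 : ℤ) • m = (2 : ℤ) • m') :
    m = m' := by
  ext x g
  have := DFunLike.congr_fun (congrArg MonoidAlgebra.coeff (DFunLike.congr_fun h x)) g
  rw [Finsupp.smul_apply, Finsupp.smul_apply, MonoidAlgebra.coeff_smul, MonoidAlgebra.coeff_smul,
    Finsupp.smul_apply, Finsupp.smul_apply] at this
  exact smul_right_injective ℤ two_ne_zero this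

/-- The kernel is not `2`-divisible. -/
theorem exists_not_sq (hker : ∃ r, E.proj r = 1 ∧ r ≠ 1) :
    ∃ r, E.proj r = 1 ∧ ∀ s, E.proj s = 1 → r ≠ s ^ 2 := by
  by_contra! hall
  have key : ∀ k : ℕ, ∀ r, E.proj r = 1 → ∃ m, E.fox r = ((2 : ℤ) ^ k) • m := by
    intro k
    induction k with
    | zero => exact fun r _ => ⟨E.fox r, by simp⟩
    | succ k ih =>
      intro r hr
      obtain ⟨s, hs, rfl⟩ := hall r hr
      obtain ⟨m, hm⟩ := ih s hs
      refine ⟨m, ?_⟩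
      rw [sq, E.fox_mul_of_proj_eq_one hs, hm, ← add_smul, pow_succ, mul_two]
  obtain ⟨r, hr, hr1⟩ := hker
  apply hr1
  apply E.eq_one_of_fox_eq_zero r hr
  ext x g
  obtain ⟨m, hm⟩ := key ((E.fox r x).coeff g).natAbs r hr
  apply Int.eq_zero_of_abs_lt_dvd (m := 2 ^ ((E.fox r x).coeff g).natAbs)
  · refine ⟨(m x).coeff g, ?_⟩
    have := DFunLike.congr_fun (congrArg MonoidAlgebra.coeff (DFunLike.congr_fun hm x)) g
    rwa [Finsupp.smul_apply, MonoidAlgebra.coeff_smul, Finsupp.smul_apply] at this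
  · rw [Int.abs_eq_natAbs]
    exact_mod_cast Nat.lt_two_pow_self

/-- The automorphism `t` acts on the kernel of the projection as a unipotent map of
class two, that is, `(t - 1) ^ 2 = 0` there. -/
def IsUnipotent (t : MulAut G) : Prop :=
  ∀ r, E.proj r = 1 → t (t r * r⁻¹) = t r * r⁻¹

variable {E} in
theorem IsUnipotent.proj_apply (hker : ∃ r, E.proj r = 1 ∧ r ≠ 1) {t : MulAut G}
    (ht : E.IsUnipotent t) (g : G) : E.proj (t g) = E.proj g := by
  have hfox : ∀ r, E.proj r = 1 → E.fox (t (t r)) = (2 : ℤ) • E.fox (t r) - E.fox r := by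
    intro r hr
    have h := ht r hr
    rw [map_mul, map_inv, mul_inv_eq_iff_eq_mul] at h
    have hr' := E.proj_mulAut t hr
    rw [h, E.fox_mul_of_proj_eq_one (by simp [hr, hr']), E.fox_mul_of_proj_eq_one hr',
      E.fox_inv_of_proj_eq_one hr, two_smul]
    abel
  have hconj : ∀ r, E.proj r = 1 → MonoidAlgebra.of ℤ Q (E.proj (t (t g))) •
      ((2 : ℤ) • E.fox (t r) - E.fox r) =
      (2 : ℤ) • MonoidAlgebra.of ℤ Q (E.proj (t g)) • E.fox (t r) -
        MonoidAlgebra.of ℤ Q (E.proj g) • E.fox r := by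
    intro r hr
    have h := hfox (g * r * g⁻¹) (E.proj_conj hr g)
    simp only [map_mul, map_inv t] at h
    rwa [E.fox_conj hr, E.fox_conj (E.proj_mulAut t hr),
      E.fox_conj (E.proj_mulAut t (E.proj_mulAut t hr)), hfox r hr] at h
  have htt : E.proj (t (t g)) = E.proj g := by
    by_contra hne
    obtain ⟨r, hr, hr'⟩ := E.exists_not_sq hker
    obtain ⟨m, hm⟩ : ∃ m, E.fox r = (2 : ℤ) • m := by
      apply exists_eq_two_smul
      intro x
      apply dvd_coeff_of_dvd_sub (h := (E.proj g)⁻¹ * E.proj (t (t g)))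
      · apply E.torsionFree
        rw [Ne, inv_mul_eq_one]
        exact fun h => hne h.symm
      · have h := congrArg (fun m => MonoidAlgebra.of ℤ Q (E.proj g)⁻¹ • m) (hconj r hr)
        simp only [smul_sub, smul_smul, ← map_mul, smul_comm _ (2 : ℤ), inv_mul_cancel,
          map_one, one_smul] at h
        have h' : MonoidAlgebra.of ℤ Q ((E.proj g)⁻¹ * E.proj (t (t g))) • E.fox r - E.fox r =
          (2 : ℤ) • (MonoidAlgebra.of ℤ Q ((E.proj g)⁻¹ * E.proj (t (t g))) • E.fox (t r) -
            MonoidAlgebra.of ℤ Q ((E.proj g)⁻¹ * E.proj (t g)) • E.fox (t r)) := by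
          rw [smul_sub, ← sub_eq_zero]
          rw [← sub_eq_zero] at h
          rw [← neg_eq_zero, ← h]
          abel
        intro q
        have h'' := DFunLike.congr_fun (congrArg MonoidAlgebra.coeff (DFunLike.congr_fun h' x)) q
        rw [Finsupp.sub_apply, Finsupp.smul_apply, smul_eq_mul] at h''
        rw [h'', Finsupp.smul_apply, MonoidAlgebra.coeff_smul, Finsupp.smul_apply]
        exact ⟨_, rfl⟩
    obtain ⟨s, hs, rfl⟩ := E.exists_sq r m hr hm
    exact hr' s hs rfl
  obtain ⟨r, hr, hr1⟩ := hker
  by_contra hne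
  have h := hconj r hr
  rw [htt, smul_sub, sub_left_inj, smul_comm _ (2 : ℤ)] at h
  have h' := congrArg (fun m => MonoidAlgebra.of ℤ Q (E.proj g)⁻¹ • m) (two_smul_injective h)
  simp only [smul_smul, ← map_mul, inv_mul_cancel, map_one, one_smul] at h'
  apply hr1
  rw [← (map_eq_one_iff t t.injective)]
  apply E.eq_one_of_fox_eq_zero _ (E.proj_mulAut t hr)
  apply fox_eq_zero_of_smul_eq E _ h'.symm
  rw [Ne, inv_mul_eq_one]
  exact fun h => hne h.symm

theorem isUnipotent_transvection {z : X} {d : G} (hd : E.proj d = 1) (hdz : E.Avoids z d)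
    {t : MulAut G} (htz : t (E.gen z) = d * E.gen z)
    (ht : ∀ x, x ≠ z → t (E.gen x) = E.gen x) : E.IsUnipotent t := by
  intro r hr
  have hr' := E.proj_mulAut t hr
  have he : E.proj (t r * r⁻¹) = 1 := by simp [hr, hr']
  have hfe : E.fox (t r * r⁻¹) = E.fox r z • E.fox d := by
    have := fox_transvection (t := t.toMonoidHom) hd htz ht r
    change E.fox (t r) = _ at this
    rw [E.fox_mul_of_proj_eq_one hr', E.fox_inv_of_proj_eq_one hr, this]
    abel
  apply E.eq_of_fox_eq (E.proj_mulAut t he) he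
  have h := E.fox_hom_of_fox_eq_smul t.toMonoidHom he hd hfe
  rw [E.inducedRing_eq_self (proj_transvection hd htz ht), hdz t.toMonoidHom ht, ← hfe] at h
  exact h

/-- The annihilator of the elements of the kernel avoiding finitely many generators is trivial. -/
theorem eq_zero_of_smul_fox_eq_zero [Infinite X] (hker : ∃ r, E.proj r = 1 ∧ r ≠ 1)
    (Z : Finset X) {w : MonoidAlgebra ℤ Q}
    (hw : ∀ d, E.proj d = 1 → (∀ z ∈ Z, E.Avoids z d) → w • E.fox d = 0) : w = 0 := by
  classical
  obtain ⟨r, hr, hr1⟩ := hker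
  obtain ⟨i, hi⟩ : ∃ i, E.fox r i ≠ 0 := by
    by_contra! h
    exact hr1 (E.eq_one_of_fox_eq_zero r hr (Finsupp.ext h))
  obtain ⟨S, hS⟩ : ∃ S : Finset X, ∀ g ∈ w.coeff.support, ∀ θ₁ θ₂ : G →* G,
      (∀ x ∈ S, θ₁ (E.gen x) = θ₂ (E.gen x)) → E.induced θ₁ g = E.induced θ₂ g := by
    choose c hc using E.proj_surjective
    choose T hT using E.exists_finset_hom_eq
    refine ⟨w.coeff.support.biUnion fun g => T (c g), fun g hg θ₁ θ₂ h => ?_⟩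
    rw [← hc g, induced_proj, induced_proj, hT (c g) θ₁ θ₂ fun x hx => h x ?_]
    exact Finset.mem_biUnion.2 ⟨g, hg, hx⟩
  obtain ⟨f, hf, hfS⟩ : ∃ f : X → X, Function.Injective f ∧ ∀ x, f x ∉ S ∪ Z := by
    have : Nonempty (X ≃ ↥((↑(S ∪ Z) : Set X)ᶜ)) := by
      rw [← Cardinal.eq]
      exact (Cardinal.mk_compl_finset_of_infinite (S ∪ Z)).symm
    obtain ⟨e⟩ := this
    exact ⟨fun x => (e x : X), Subtype.val_injective.comp e.injective, fun x => (e x).2⟩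
  obtain ⟨θ, hθ⟩ := E.exists_hom fun x => E.gen (f x)
  obtain ⟨κ, hκ⟩ := E.exists_hom fun x => if x ∈ S then 1 else E.gen x
  obtain ⟨θ', hθ'⟩ := E.exists_hom fun x => E.gen (Function.invFun f x)
  have hκθ : κ.comp θ = θ := E.hom_ext fun x => by
    have : f x ∉ S := fun h => hfS x (Finset.mem_union_left _ h)
    simp [hθ, hκ, this]
  have hθ'θ : θ'.comp θ = MonoidHom.id G := E.hom_ext fun x => by
    simp [hθ, hθ', Function.leftInverse_invFun hf x]
  have hinj : Function.Injective (E.induced θ) := by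
    have : Function.LeftInverse (E.induced θ') (E.induced θ) := fun q => by
      obtain ⟨g, rfl⟩ := E.proj_surjective q
      rw [induced_proj, induced_proj, ← MonoidHom.comp_apply θ' θ, hθ'θ, MonoidHom.id_apply]
    exact this.injective
  have h := DFunLike.congr_fun (hw (θ r) (E.proj_hom θ r hr) fun z hz η hη => by
    have : η.comp θ = θ := E.hom_ext fun x => by
      have : f x ≠ z := by rintro rfl; exact hfS x (Finset.mem_union_right _ hz)
      simp [hθ, hη _ this]
    rw [← MonoidHom.comp_apply η θ, this]) (f i)
  rw [Finsupp.smul_apply, smul_eq_mul, E.fox_hom_gen_apply hf hθ, Finsupp.zero_apply] at h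
  obtain ⟨b, hb⟩ : ∃ b, (E.fox r i).coeff b ≠ 0 := by
    by_contra! hb
    exact hi (MonoidAlgebra.coeff_eq_zero.1 (Finsupp.ext hb))
  have hκw : ∀ g ∈ w.coeff.support, E.induced κ g = 1 := by
    intro g hg
    obtain ⟨η, hη⟩ := E.exists_hom fun _ => (1 : G)
    rw [hS g hg κ η fun x hx => by rw [hκ, if_pos hx, hη]]
    obtain ⟨c, rfl⟩ := E.proj_surjective g
    have : η = 1 := E.hom_ext fun x => by simp [hη]
    simp [this]
  have hκb : ∀ k, E.induced κ (E.induced θ k) = E.induced θ k := by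
    intro k
    obtain ⟨c, rfl⟩ := E.proj_surjective k
    rw [induced_proj, induced_proj, ← MonoidHom.comp_apply κ θ, hκθ]
  rw [← MonoidAlgebra.coeff_eq_zero]
  ext a
  by_contra ha
  have hcoeff : (E.inducedRing θ (E.fox r i)).coeff = (E.fox r i).coeff.mapDomain (E.induced θ) :=
    rfl
  have huniq : UniqueMul w.coeff.support (E.inducedRing θ (E.fox r i)).coeff.support a
      (E.induced θ b) := by
    intro a' b' ha' hb' hab
    rw [hcoeff] at hb'
    obtain ⟨k, _, rfl⟩ := Finset.mem_image.1 (Finsupp.mapDomain_support hb')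
    have := congrArg (E.induced κ) hab
    rw [map_mul, map_mul, hκw a' ha', hκw a (Finsupp.mem_support_iff.2 ha), hκb, hκb, one_mul,
      one_mul] at this
    rw [this] at hab
    exact ⟨mul_right_cancel hab, this⟩
  have := MonoidAlgebra.coeff_mul_mul_of_uniqueMul huniq
  rw [h, hcoeff, Finsupp.mapDomain_apply hinj] at this
  exact mul_ne_zero ha hb this.symm

/-- The action of `φ` on the kernel of the projection commutes with that of all unipotent
automorphisms. -/
def CentralizesUnipotents (φ : MulAut G) : Prop :=
  ∀ t, E.IsUnipotent t → ∀ r, E.proj r = 1 → φ (t r) = t (φ r)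

section CentralizesUnipotents

variable {E} {φ ψ : MulAut G}

theorem CentralizesUnipotents.mul (hφ : E.CentralizesUnipotents φ)
    (hψ : E.CentralizesUnipotents ψ) : E.CentralizesUnipotents (φ * ψ) := fun t ht r hr => by
  rw [MulAut.mul_apply, MulAut.mul_apply, hψ t ht r hr, hφ t ht _ (E.proj_mulAut ψ hr)]

theorem CentralizesUnipotents.inv (hφ : E.CentralizesUnipotents φ) :
    E.CentralizesUnipotents φ⁻¹ := fun t ht r hr => by
  rw [MulAut.inv_apply, MulEquiv.symm_apply_eq, hφ t ht _ (E.proj_mulAut φ⁻¹ hr),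
    MulAut.inv_apply, MulEquiv.apply_symm_apply]

theorem centralizesUnipotents_conj (hker : ∃ r, E.proj r = 1 ∧ r ≠ 1) (g : G) :
    E.CentralizesUnipotents (MulAut.conj g) := fun t ht r hr => by
  have htr := E.proj_mulAut t hr
  simp only [MulAut.conj_apply, map_mul, map_inv]
  apply E.eq_of_fox_eq (E.proj_conj htr _) (E.proj_conj htr _)
  rw [E.fox_conj htr, E.fox_conj htr, ht.proj_apply hker]

variable [Infinite X]
  (hDyer : ∀ φ : MulAut G, (∀ r, E.proj r = 1 → φ r = r) →
    ∃ c, E.proj c = 1 ∧ ∀ g, φ g = c * g * c⁻¹)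
  (hker : ∃ r, E.proj r = 1 ∧ r ≠ 1)

include hDyer

theorem CentralizesUnipotents.exists_finset (hφ : E.CentralizesUnipotents φ) :
    ∃ S : Finset X, ∀ z ∉ S, ∀ d, E.proj d = 1 → E.Avoids z d → ∀ t : MulAut G,
      t (E.gen z) = d * E.gen z → (∀ x, x ≠ z → t (E.gen x) = E.gen x) →
        ∀ g, φ (t g) = t (φ g) := by
  classical
  obtain ⟨x⟩ : Nonempty X := inferInstance
  obtain ⟨S, hS⟩ := E.exists_finset_avoids (φ (E.gen x))
  refine ⟨insert x S, fun z hz d hd hdz t htz ht => ?_⟩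
  rw [Finset.mem_insert, not_or] at hz
  have htu := E.isUnipotent_transvection hd hdz htz ht
  obtain ⟨c, hc, hcφ⟩ := hDyer (φ * t * φ⁻¹ * t⁻¹) fun r hr => by
    have hr' := E.proj_mulAut φ⁻¹ (E.proj_mulAut t⁻¹ hr)
    simp only [MulAut.mul_apply]
    rw [hφ t htu _ hr']
    simp
  have hcomm : ∀ g, φ (t g) = c * t (φ g) * c⁻¹ := fun g => by
    rw [← hcφ]
    simp [MulAut.mul_apply]
  have htφ : t (φ (E.gen x)) = φ (E.gen x) := hS z hz.2 t.toMonoidHom ht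
  have hc1 : c = 1 := by
    apply E.eq_one_of_conj_eq hc (g := φ (E.gen x))
    · rw [Ne, E.proj_mulAut_iff]
      exact E.proj_gen_ne_one x
    · have := hcomm (E.gen x)
      rw [ht x (Ne.symm hz.1), htφ, eq_mul_inv_iff_mul_eq] at this
      rw [this, mul_inv_cancel_right]
  intro g
  rw [hcomm, hc1, one_mul, inv_one, mul_one]

include hker

/-- An automorphism centralizing the unipotent automorphisms acts on the kernel of the projection
as a scalar. -/
theorem CentralizesUnipotents.exists_smul (hφ : E.CentralizesUnipotents φ) :
    ∃ (S : Finset X) (u : MonoidAlgebra ℤ Q),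
      (∀ z ∉ S, E.fox (φ (E.gen z)) z = u ∧ ∀ x, x ≠ z → E.fox (φ (E.gen x)) z = 0) ∧
      ∀ d, E.proj d = 1 → E.fox (φ d) = u • E.fox d := by
  classical
  obtain ⟨S, hS⟩ := hφ.exists_finset hDyer
  have hdiag : ∀ z ∉ S, ∀ d, E.proj d = 1 → E.Avoids z d →
      E.fox (φ d) = E.fox (φ (E.gen z)) z • E.fox d := by
    intro z hz d hd hdz
    obtain ⟨t, htz, ht⟩ := E.exists_transvection hdz
    have h := congrArg E.fox (hS z hz d hd hdz t htz ht (E.gen z))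
    have h' := fox_transvection (t := t.toMonoidHom) hd htz ht (φ (E.gen z))
    rw [htz, map_mul, E.fox_mul_of_proj_eq_one (E.proj_mulAut φ hd), add_comm] at h
    exact add_left_cancel (h.trans h')
  have hoff : ∀ z ∉ S, ∀ x, x ≠ z → E.fox (φ (E.gen x)) z = 0 := by
    intro z hz x hx
    apply E.eq_zero_of_smul_fox_eq_zero hker {z}
    intro d hd hdz
    obtain ⟨t, htz, ht⟩ := E.exists_transvection (hdz z (Finset.mem_singleton_self z))
    have h := congrArg E.fox
      (hS z hz d hd (hdz z (Finset.mem_singleton_self z)) t htz ht (E.gen x))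
    have h' := fox_transvection (t := t.toMonoidHom) hd htz ht (φ (E.gen x))
    rw [ht x hx] at h
    exact left_eq_add.1 (h.trans h')
  obtain ⟨z₀, hz₀⟩ := Infinite.exists_notMem_finset S
  have hu : ∀ z ∉ S, E.fox (φ (E.gen z)) z = E.fox (φ (E.gen z₀)) z₀ := by
    intro z hz
    rw [← sub_eq_zero]
    apply E.eq_zero_of_smul_fox_eq_zero hker {z, z₀}
    intro d hd hdz
    rw [sub_smul, ← hdiag z hz d hd (hdz z (by simp)), ← hdiag z₀ hz₀ d hd (hdz z₀ (by simp)),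
      sub_self]
  refine ⟨S, E.fox (φ (E.gen z₀)) z₀, fun z hz => ⟨hu z hz, hoff z hz⟩, fun d hd => ?_⟩
  obtain ⟨T, hT⟩ := E.exists_finset_avoids d
  obtain ⟨z, hz⟩ := Infinite.exists_notMem_finset (S ∪ T)
  rw [Finset.mem_union, not_or] at hz
  rw [hdiag z hz.1 d hd (hT z hz.2), hu z hz.1]

/-- An automorphism centralizing the unipotent automorphisms does not invert the kernel. -/
theorem CentralizesUnipotents.not_forall_fox_eq_neg (hφ : E.CentralizesUnipotents φ) :
    ¬ ∀ d, E.proj d = 1 → E.fox (φ d) = -E.fox d := by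
  classical
  intro hneg
  obtain ⟨S, u, hu, hsmul⟩ := hφ.exists_smul hDyer hker
  obtain rfl : u = -1 := by
    rw [← sub_eq_zero]
    apply E.eq_zero_of_smul_fox_eq_zero hker ∅
    intro d hd _
    rw [sub_smul, ← hsmul d hd, hneg d hd, neg_smul, one_smul, sub_self]
  have hφproj : ∀ g, E.proj (φ g) = E.proj g := by
    intro g
    obtain ⟨r, hr, hr1⟩ := hker
    have h := hneg _ (E.proj_conj hr g)
    rw [map_mul, map_mul, map_inv, E.fox_conj (E.proj_mulAut φ hr), E.fox_conj hr, hneg r hr,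
      smul_neg, neg_inj, ← E.fox_conj hr, ← E.fox_conj hr] at h
    have h' := E.eq_of_fox_eq (E.proj_conj hr _) (E.proj_conj hr _) h
    have : E.proj (g⁻¹ * φ g) = 1 := by
      apply E.proj_eq_one_of_conj_eq hr hr1
      calc g⁻¹ * φ g * r * (g⁻¹ * φ g)⁻¹ = g⁻¹ * (φ g * r * (φ g)⁻¹) * g := by group
        _ = r := by rw [h']; group
    rw [map_mul, map_inv, inv_mul_eq_one] at this
    exact this.symm
  obtain ⟨z, hz⟩ := Infinite.exists_notMem_finset S
  obtain ⟨κ, hκ⟩ := E.exists_hom fun x => if x ∈ S then 1 else E.gen x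
  have h := congrArg (E.inducedRing κ) (E.linearCombination_fox (φ (E.gen z)))
  rw [Finsupp.linearCombination_apply, Finsupp.sum, map_sum, Finset.sum_eq_single z] at h
  · rw [smul_eq_mul, map_mul, (hu z hz).1, hφproj, map_neg, map_one, map_sub, inducedRing_of,
      hκ, if_neg hz, map_one, neg_one_mul, ← sub_eq_zero] at h
    apply E.proj_gen_ne_one z
    apply MonoidAlgebra.of_injective (R := ℤ)
    rw [map_one, ← sub_eq_zero]
    have h2 : (2 : ℤ) • (MonoidAlgebra.of ℤ Q (E.proj (E.gen z)) - 1) = 0 := by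
      rw [two_smul, ← neg_eq_zero, ← h]
      abel
    exact (smul_eq_zero.1 h2).resolve_left two_ne_zero
  · intro x _ hx
    rw [smul_eq_mul, map_mul]
    by_cases hxS : x ∈ S
    · rw [map_sub, inducedRing_of, hκ, if_pos hxS, map_one, map_one, map_one, sub_self, mul_zero]
    · rw [(hu x hxS).2 z hx.symm, map_zero, zero_mul]
  · intro hz'
    rw [Finsupp.notMem_support_iff.1 hz', zero_smul, map_zero]

/-- The automorphisms centralizing the unipotent automorphisms are the inner ones. -/
theorem centralizesUnipotents_iff (hUnits : ∀ u : (MonoidAlgebra ℤ Q)ˣ,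
      ∃ g, (u : MonoidAlgebra ℤ Q) = MonoidAlgebra.of ℤ Q g ∨
        (u : MonoidAlgebra ℤ Q) = -MonoidAlgebra.of ℤ Q g) :
    E.CentralizesUnipotents φ ↔ ∃ g, φ = MulAut.conj g := by
  refine ⟨fun hφ => ?_, ?_⟩
  swap
  · rintro ⟨g, rfl⟩
    exact centralizesUnipotents_conj hker g
  have key : ∀ φ : MulAut G, ∀ u v, (∀ d, E.proj d = 1 → E.fox (φ d) = u • E.fox d) →
      (∀ d, E.proj d = 1 → E.fox (φ⁻¹ d) = v • E.fox d) →
      E.inducedRing φ.toMonoidHom v * u = 1 := by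
    intro φ u v hu hv
    rw [← sub_eq_zero]
    apply E.eq_zero_of_smul_fox_eq_zero hker ∅
    intro d hd _
    have := E.fox_hom_of_fox_eq_smul φ.toMonoidHom (E.proj_mulAut φ⁻¹ hd) hd (hv d hd)
    change E.fox (φ (φ⁻¹ d)) = _ • E.fox (φ d) at this
    rw [hu d hd, MulAut.apply_inv_self] at this
    rw [sub_smul, mul_smul, ← this, one_smul, sub_self]
  obtain ⟨-, u, -, hu⟩ := hφ.exists_smul hDyer hker
  obtain ⟨-, v, -, hv⟩ := hφ.inv.exists_smul hDyer hker
  have h₁ := key φ u v hu hv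
  have h₂ : u * E.inducedRing φ.toMonoidHom v = 1 := by
    have := congrArg (E.inducedRing φ.toMonoidHom) (key φ⁻¹ v u hv (by rwa [inv_inv]))
    rw [map_mul, map_one, ← inducedRing_comp] at this
    rwa [show φ.toMonoidHom.comp (φ⁻¹).toMonoidHom = MonoidHom.id G from
      MonoidHom.ext fun g => MulEquiv.apply_symm_apply φ g, inducedRing_id] at this
  obtain ⟨q, hq⟩ := hUnits ⟨u, _, h₂, h₁⟩
  obtain ⟨h, rfl⟩ := E.proj_surjective q
  have hψ : E.CentralizesUnipotents ((MulAut.conj h)⁻¹ * φ) :=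
    (centralizesUnipotents_conj hker h).inv.mul hφ
  have hfox : ∀ d, E.proj d = 1 → E.fox (((MulAut.conj h)⁻¹ * φ) d) =
      MonoidAlgebra.of ℤ Q (E.proj h)⁻¹ • u • E.fox d := by
    intro d hd
    have := E.fox_conj (E.proj_mulAut φ hd) h⁻¹
    rw [inv_inv, hu d hd, map_inv] at this
    simpa [MulAut.mul_apply] using this
  rcases hq with hq | hq
  · obtain ⟨c, -, hc⟩ := hDyer _ fun d hd => E.eq_of_fox_eq (E.proj_mulAut _ hd) hd (by
      rw [hfox d hd]
      change u = _ at hq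
      rw [hq, smul_smul, ← map_mul, inv_mul_cancel, map_one, one_smul])
    refine ⟨h * c, ?_⟩
    have : (MulAut.conj h)⁻¹ * φ = MulAut.conj c := by
      ext g
      rw [hc, MulAut.conj_apply]
    rw [map_mul, ← this, mul_inv_cancel_left]
  · refine absurd (fun d hd => ?_) (hψ.not_forall_fox_eq_neg hDyer hker)
    rw [hfox d hd]
    change u = _ at hq
    rw [hq, neg_smul, smul_neg, smul_smul, ← map_mul, inv_mul_cancel, map_one, one_smul]

end CentralizesUnipotents

section Complete

variable {E} [Infinite X]
  (hDyer : ∀ φ : MulAut G, (∀ r, E.proj r = 1 → φ r = r) →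
    ∃ c, E.proj c = 1 ∧ ∀ g, φ g = c * g * c⁻¹)
  (hker : ∃ r, E.proj r = 1 ∧ r ≠ 1)

include hDyer

omit [Infinite X] in
theorem exists_eq_conj {φ : MulAut G} (hφ : ∀ r, E.proj r = 1 → φ r = r) :
    ∃ c, E.proj c = 1 ∧ φ = MulAut.conj c := by
  obtain ⟨c, hc, h⟩ := hDyer φ hφ
  exact ⟨c, hc, MulEquiv.ext h⟩

theorem forall_apply_eq_iff_commute {φ : MulAut G} :
    (∀ r, E.proj r = 1 → φ r = r) ↔ ∀ ψ : MulAut G, Commute φ (ψ * φ * ψ⁻¹) := by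
  refine ⟨fun h ψ => ?_, fun h r hr => E.apply_eq_of_commute_conj h hr⟩
  obtain ⟨c, hc, rfl⟩ := exists_eq_conj hDyer h
  rw [mul_conj_mul_inv]
  exact (E.commute_of_proj_eq_one hc (E.proj_mulAut ψ hc)).map MulAut.conj

theorem forall_apply_eq_map (Φ : MulAut (MulAut G)) {φ : MulAut G}
    (hφ : ∀ r, E.proj r = 1 → φ r = r) : ∀ r, E.proj r = 1 → Φ φ r = r := by
  rw [forall_apply_eq_iff_commute hDyer] at hφ ⊢
  intro ψ
  obtain ⟨ψ, rfl⟩ := Φ.surjective ψ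
  rw [← map_mul, ← map_inv, ← map_mul]
  exact (hφ ψ).map Φ

include hker

theorem isUnipotent_iff_commute {t : MulAut G} :
    E.IsUnipotent t ↔ ∀ a : MulAut G, (∀ r, E.proj r = 1 → a r = r) →
      Commute t (t * a * t⁻¹ * a⁻¹) := by
  have key : ∀ c, Commute t (t * MulAut.conj c * t⁻¹ * (MulAut.conj c)⁻¹) ↔
      t (t c * c⁻¹) = t c * c⁻¹ := by
    intro c
    rw [mul_conj_mul_inv, ← map_inv, ← map_mul, ← (E.conj_injective hker).eq_iff,
      ← mul_conj_mul_inv, mul_inv_eq_iff_eq_mul]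
    rfl
  constructor
  · intro ht a ha
    obtain ⟨c, hc, rfl⟩ := exists_eq_conj hDyer ha
    exact (key c).2 (ht c hc)
  · intro h c hc
    refine (key c).1 (h _ fun r hr => ?_)
    rw [MulAut.conj_apply, (E.commute_of_proj_eq_one hc hr).eq, mul_inv_cancel_right]

theorem IsUnipotent.map (Φ : MulAut (MulAut G)) {t : MulAut G} (ht : E.IsUnipotent t) :
    E.IsUnipotent (Φ t) := by
  rw [isUnipotent_iff_commute hDyer hker] at ht ⊢
  intro a ha
  have := (ht (Φ⁻¹ a) (forall_apply_eq_map hDyer Φ⁻¹ ha)).map Φ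
  simpa using this

theorem CentralizesUnipotents.map (Φ : MulAut (MulAut G)) {φ : MulAut G}
    (hφ : E.CentralizesUnipotents φ) : E.CentralizesUnipotents (Φ φ) := by
  intro t ht r hr
  have h := forall_apply_eq_map hDyer Φ (φ := φ * Φ⁻¹ t * φ⁻¹ * (Φ⁻¹ t)⁻¹) fun r hr => by
    simp only [MulAut.mul_apply]
    rw [hφ _ (ht.map hDyer hker Φ⁻¹) _ (E.proj_mulAut φ⁻¹ (E.proj_mulAut (Φ⁻¹ t)⁻¹ hr))]
    simp
  have h' := h (t (Φ φ r)) (E.proj_mulAut t (E.proj_mulAut (Φ φ) hr))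
  simpa [MulAut.mul_apply] using h'

omit hDyer in
theorem center_mulAut_eq_bot : Subgroup.center (MulAut G) = ⊥ := by
  rw [eq_bot_iff]
  intro φ hφ
  rw [Subgroup.mem_center_iff] at hφ
  rw [Subgroup.mem_bot]
  ext g
  apply E.conj_injective hker
  rw [← mul_conj_mul_inv, ← hφ, mul_inv_cancel_right, MulAut.one_apply]

theorem exists_mulAut_eq_conj (hUnits : ∀ u : (MonoidAlgebra ℤ Q)ˣ,
      ∃ g, (u : MonoidAlgebra ℤ Q) = MonoidAlgebra.of ℤ Q g ∨
        (u : MonoidAlgebra ℤ Q) = -MonoidAlgebra.of ℤ Q g) (Φ : MulAut (MulAut G)) :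
    ∃ ψ : MulAut G, ∀ φ, Φ φ = ψ * φ * ψ⁻¹ := by
  have hinj := E.conj_injective hker
  have h : ∀ Φ : MulAut (MulAut G), ∀ g, ∃ g', Φ (MulAut.conj g) = MulAut.conj g' := fun Φ g =>
    (centralizesUnipotents_iff hDyer hker hUnits).1
      ((centralizesUnipotents_conj hker g).map hDyer hker Φ)
  choose β hβ using h Φ
  choose γ hγ using h Φ⁻¹
  let ψ : MulAut G :=
    { toFun := β
      invFun := γ
      left_inv := fun g => hinj (by rw [← hγ, ← hβ, MulAut.inv_apply_self])
      right_inv := fun g => hinj (by rw [← hβ, ← hγ, MulAut.apply_inv_self])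
      map_mul' := fun g g' => hinj (by rw [← hβ, map_mul, map_mul, hβ, hβ, map_mul]) }
  have hψ : ∀ g, Φ (MulAut.conj g) = MulAut.conj (ψ g) := hβ
  refine ⟨ψ, fun φ => ?_⟩
  rw [eq_mul_inv_iff_mul_eq]
  ext g
  apply hinj
  rw [MulAut.mul_apply, MulAut.mul_apply, ← mul_conj_mul_inv, ← hψ, ← hψ, ← mul_conj_mul_inv φ,
    map_mul, map_mul, map_inv]

end Complete

end MagnusExtension

namespace FreeGroupQuotient

variable {X : Type*} (R : Subgroup (FreeGroup X)) [R.Normal]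

section Fox

/-- The affine action of the free group on the free `ℤ[F/R]`-module with basis `X`, in which a
generator `x` acts by `m ↦ x m + e_x`. -/
noncomputable def foxPerm :
    FreeGroup X →* Equiv.Perm (X →₀ MonoidAlgebra ℤ (FreeGroup X ⧸ R)) :=
  FreeGroup.lift fun x =>
    { toFun := fun m => MonoidAlgebra.of ℤ (FreeGroup X ⧸ R) (FreeGroup.of x : FreeGroup X) • m +
        Finsupp.single x 1
      invFun := fun m =>
        MonoidAlgebra.of ℤ (FreeGroup X ⧸ R) (FreeGroup.of x : FreeGroup X)⁻¹ •
          (m - Finsupp.single x 1)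
      left_inv := fun m => by
        beta_reduce
        rw [add_sub_cancel_right, smul_smul, ← map_mul, inv_mul_cancel, map_one, one_smul]
      right_inv := fun m => by
        beta_reduce
        rw [smul_smul, ← map_mul, mul_inv_cancel, map_one, one_smul, sub_add_cancel] }

theorem foxPerm_of (x : X) (m : X →₀ MonoidAlgebra ℤ (FreeGroup X ⧸ R)) :
    foxPerm R (FreeGroup.of x) m =
      MonoidAlgebra.of ℤ (FreeGroup X ⧸ R) (FreeGroup.of x : FreeGroup X) • m +
        Finsupp.single x 1 := by
  rw [foxPerm, FreeGroup.lift_apply_of]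
  rfl

theorem foxPerm_apply (w : FreeGroup X) (m : X →₀ MonoidAlgebra ℤ (FreeGroup X ⧸ R)) :
    foxPerm R w m = MonoidAlgebra.of ℤ (FreeGroup X ⧸ R) w • m + foxPerm R w 0 := by
  induction w using FreeGroup.induction_on generalizing m with
  | C1 =>
    rw [QuotientGroup.mk_one, map_one, map_one, one_smul, Equiv.Perm.one_apply,
      Equiv.Perm.one_apply, add_zero]
  | of x => rw [foxPerm_of, foxPerm_of, smul_zero, zero_add]
  | inv_of x ih =>
    rw [map_inv, Equiv.Perm.inv_eq_iff_eq, foxPerm_of, smul_add, smul_smul, QuotientGroup.mk_inv,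
      ← map_mul, mul_inv_cancel, map_one, one_smul, add_assoc, ← foxPerm_of,
      ← Equiv.Perm.mul_apply, mul_inv_cancel, Equiv.Perm.one_apply, add_zero]
  | mul v w hv hw =>
    rw [map_mul, Equiv.Perm.mul_apply, Equiv.Perm.mul_apply, hw, hv, hv (foxPerm R w 0),
      QuotientGroup.mk_mul, map_mul, mul_smul, smul_add, add_assoc]

theorem foxPerm_mul_zero (v w : FreeGroup X) :
    foxPerm R (v * w) 0 =
      foxPerm R v 0 + MonoidAlgebra.of ℤ (FreeGroup X ⧸ R) v • foxPerm R w 0 := by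
  rw [map_mul, Equiv.Perm.mul_apply, foxPerm_apply, add_comm]

theorem commutator_le_ker_foxPerm : ⁅R, R⁆ ≤ (foxPerm R).ker := by
  rw [Subgroup.commutator_le]
  intro v hv w hw
  rw [MonoidHom.mem_ker, map_commutatorElement, commutatorElement_eq_one_iff_mul_comm]
  ext1 m
  have h : ∀ u ∈ R, ∀ m, foxPerm R u m = m + foxPerm R u 0 := fun u hu m => by
    rw [foxPerm_apply, (QuotientGroup.eq_one_iff u).2 hu, map_one, one_smul]
  rw [Equiv.Perm.mul_apply, Equiv.Perm.mul_apply, h v hv, h w hw, h w hw (foxPerm R v m),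
    h v hv m, add_right_comm]

end Fox

section Relation

/-- The Reidemeister–Schreier cocycle: for a transversal of `R`, the class of
`q̃ * w * (q * w)~⁻¹` in the abelianization of `R`. -/
noncomputable def relationCocycle (q : FreeGroup X ⧸ R) (w : FreeGroup X) :
    Additive (Abelianization R) :=
  Additive.ofMul (Abelianization.of
    ⟨q.out * w * (q * (w : FreeGroup X ⧸ R)).out⁻¹, by
      rw [← QuotientGroup.eq_one_iff, QuotientGroup.mk_mul, QuotientGroup.mk_mul,
        QuotientGroup.mk_inv, QuotientGroup.out_eq', QuotientGroup.out_eq', mul_inv_cancel]⟩)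

theorem relationCocycle_mul (q : FreeGroup X ⧸ R) (v w : FreeGroup X) :
    relationCocycle R q (v * w) =
      relationCocycle R q v + relationCocycle R (q * (v : FreeGroup X ⧸ R)) w := by
  rw [relationCocycle, relationCocycle, relationCocycle, ← ofMul_mul, ← map_mul]
  congr 2
  ext1
  simp only [Subgroup.coe_mul, QuotientGroup.mk_mul, mul_assoc, inv_mul_cancel_left]

theorem relationCocycle_one (q : FreeGroup X ⧸ R) : relationCocycle R q 1 = 0 := by
  have := relationCocycle_mul R q 1 1
  rw [mul_one, QuotientGroup.mk_one, mul_one] at this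
  exact left_eq_add.1 this

theorem relationCocycle_of_mem {w : FreeGroup X} (hw : w ∈ R) :
    relationCocycle R 1 w = Additive.ofMul (Abelianization.of ⟨w, hw⟩) := by
  have h1 : (1 : FreeGroup X ⧸ R).out ∈ R := by
    rw [← QuotientGroup.eq_one_iff, QuotientGroup.out_eq']
  have hw1 : (1 : FreeGroup X ⧸ R) * (w : FreeGroup X ⧸ R) = 1 := by
    rw [(QuotientGroup.eq_one_iff w).2 hw, mul_one]
  have h : (⟨(1 : FreeGroup X ⧸ R).out, h1⟩ * ⟨w, hw⟩ * ⟨(1 : FreeGroup X ⧸ R).out, h1⟩⁻¹ : R) =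
      ⟨(1 : FreeGroup X ⧸ R).out * w * (1 * (w : FreeGroup X ⧸ R)).out⁻¹, by
        rw [hw1]; exact R.mul_mem (R.mul_mem h1 hw) (R.inv_mem h1)⟩ := by
    ext1
    simp only [hw1, Subgroup.coe_mul, Subgroup.coe_inv]
  rw [relationCocycle, ← h, map_mul Abelianization.of, map_mul Abelianization.of, mul_right_comm,
    ← map_mul Abelianization.of, mul_inv_cancel, map_one Abelianization.of, one_mul]

/-- The retraction of the free module onto the relation module. -/
noncomputable def relationMap :
    (X →₀ MonoidAlgebra ℤ (FreeGroup X ⧸ R)) →+ Additive (Abelianization R) :=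
  Finsupp.liftAddHom fun x =>
    (Finsupp.linearCombination ℤ fun q => relationCocycle R q (FreeGroup.of x)).toAddMonoidHom.comp
      MonoidAlgebra.coeffAddEquiv.toAddMonoidHom

theorem relationMap_of_smul (q : FreeGroup X ⧸ R) (w : FreeGroup X) :
    relationMap R (MonoidAlgebra.of ℤ (FreeGroup X ⧸ R) q • foxPerm R w 0) =
      relationCocycle R q w := by
  induction w using FreeGroup.induction_on generalizing q with
  | C1 => rw [map_one, Equiv.Perm.one_apply, smul_zero, map_zero, relationCocycle_one]
  | of x =>
    rw [foxPerm_of, smul_zero, zero_add, Finsupp.smul_single, smul_eq_mul, mul_one, relationMap,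
      Finsupp.liftAddHom_apply_single]
    change Finsupp.linearCombination ℤ _ (Finsupp.single q (1 : ℤ)) = _
    rw [Finsupp.linearCombination_single, one_smul]
  | inv_of x ih =>
    have h := foxPerm_mul_zero R (FreeGroup.of x)⁻¹ (FreeGroup.of x)
    rw [inv_mul_cancel, map_one, Equiv.Perm.one_apply] at h
    have h' := congrArg (fun m => relationMap R (MonoidAlgebra.of ℤ (FreeGroup X ⧸ R) q • m)) h
    simp only [smul_zero, smul_add, map_add, map_zero, smul_smul, ← map_mul, ih] at h'
    have h'' := relationCocycle_mul R q (FreeGroup.of x)⁻¹ (FreeGroup.of x)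
    rw [inv_mul_cancel, relationCocycle_one] at h''
    exact add_right_cancel (h'.symm.trans h'')
  | mul v w hv hw =>
    rw [foxPerm_mul_zero, smul_add, map_add, hv, smul_smul, ← map_mul, hw, relationCocycle_mul]

theorem relationMap_foxPerm {w : FreeGroup X} (hw : w ∈ R) :
    relationMap R (foxPerm R w 0) = Additive.ofMul (Abelianization.of ⟨w, hw⟩) := by
  rw [← relationCocycle_of_mem, ← relationMap_of_smul, map_one, one_smul]

omit [R.Normal] in
theorem mem_commutator_of_abelianization_eq_one {w : FreeGroup X} (hw : w ∈ R)
    (h : Abelianization.of (⟨w, hw⟩ : R) = 1) : w ∈ ⁅R, R⁆ := by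
  rw [← MonoidHom.mem_ker, Abelianization.ker_of] at h
  rw [← Subgroup.map_subtype_commutator]
  exact ⟨_, h, rfl⟩

end Relation

section Extension

/-- The projection `F/R' → F/R`. -/
def quotientCommutatorProj : FreeGroup X ⧸ ⁅R, R⁆ →* FreeGroup X ⧸ R :=
  QuotientGroup.map _ _ (MonoidHom.id _) (Subgroup.commutator_le_left R R)

theorem quotientCommutatorProj_mk_eq_one {w : FreeGroup X} :
    quotientCommutatorProj R (w : FreeGroup X ⧸ ⁅R, R⁆) = 1 ↔ w ∈ R :=
  QuotientGroup.eq_one_iff w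

theorem quotientCommutatorProj_eq_one {g : FreeGroup X ⧸ ⁅R, R⁆} :
    quotientCommutatorProj R g = 1 ↔ g ∈ R.map (QuotientGroup.mk' ⁅R, R⁆) := by
  constructor
  · obtain ⟨w, rfl⟩ := QuotientGroup.mk_surjective g
    intro h
    exact ⟨w, (quotientCommutatorProj_mk_eq_one R).1 h, rfl⟩
  · rintro ⟨w, hw, rfl⟩
    exact (quotientCommutatorProj_mk_eq_one R).2 hw

/-- The Magnus embedding of the quotient of the free group by the commutator subgroup of `R`. -/
noncomputable def foxQuotient :
    FreeGroup X ⧸ ⁅R, R⁆ →* Equiv.Perm (X →₀ MonoidAlgebra ℤ (FreeGroup X ⧸ R)) :=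
  QuotientGroup.lift ⁅R, R⁆ (foxPerm R) (commutator_le_ker_foxPerm R)

theorem foxQuotient_mk (w : FreeGroup X) :
    foxQuotient R (w : FreeGroup X ⧸ ⁅R, R⁆) = foxPerm R w := rfl

theorem quotientCommutator_closure :
    Subgroup.closure (Set.range fun x : X => ((FreeGroup.of x : FreeGroup X) :
      FreeGroup X ⧸ ⁅R, R⁆)) = ⊤ := by
  have := congrArg (Subgroup.map (QuotientGroup.mk' ⁅R, R⁆)) (FreeGroup.closure_range_of X)
  rw [MonoidHom.map_closure, ← Set.range_comp,
    Subgroup.map_top_of_surjective _ (QuotientGroup.mk'_surjective _)] at this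
  exact this

variable {R} (hR : ∀ f : FreeGroup X →* FreeGroup X, R.map f ≤ R)
include hR

omit [R.Normal] in
theorem of_notMem_of_ne_top (hRproper : R ≠ ⊤) (x : X) : FreeGroup.of x ∉ R := by
  intro hx
  apply hRproper
  rw [eq_top_iff, ← FreeGroup.closure_range_of, Subgroup.closure_le]
  rintro _ ⟨y, rfl⟩
  exact hR (FreeGroup.lift fun _ => FreeGroup.of y) ⟨_, hx, FreeGroup.lift_apply_of⟩

theorem exists_quotientCommutator_hom (v : X → FreeGroup X ⧸ ⁅R, R⁆) :
    ∃ θ : FreeGroup X ⧸ ⁅R, R⁆ →* FreeGroup X ⧸ ⁅R, R⁆,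
      (∀ x, θ (FreeGroup.of x : FreeGroup X) = v x) ∧
      ∀ g, quotientCommutatorProj R g = 1 → quotientCommutatorProj R (θ g) = 1 := by
  choose w hw using fun x => QuotientGroup.mk_surjective (v x)
  refine ⟨QuotientGroup.map _ _ (FreeGroup.lift w) ?_, fun x => ?_, fun g => ?_⟩
  · rw [← Subgroup.map_le_iff_le_comap, Subgroup.map_commutator]
    exact Subgroup.commutator_mono (hR _) (hR _)
  · rw [QuotientGroup.map_mk, FreeGroup.lift_apply_of, hw]
  · obtain ⟨u, rfl⟩ := QuotientGroup.mk_surjective g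
    rw [QuotientGroup.map_mk, quotientCommutatorProj_mk_eq_one, quotientCommutatorProj_mk_eq_one]
    exact fun hu => hR _ ⟨u, hu, rfl⟩

/-- The extension `F/R' → F/R` with its Magnus embedding. -/
noncomputable def magnusExtension (hRproper : R ≠ ⊤)
    (hTF : ∀ g : FreeGroup X ⧸ R, g ≠ 1 → ∀ n : ℕ, n ≠ 0 → g ^ n ≠ 1) :
    MagnusExtension X (FreeGroup X ⧸ ⁅R, R⁆) (FreeGroup X ⧸ R) where
  proj := quotientCommutatorProj R
  gen x := (FreeGroup.of x : FreeGroup X)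
  fox g := foxQuotient R g 0
  proj_surjective q := by
    obtain ⟨w, rfl⟩ := QuotientGroup.mk_surjective q
    exact ⟨w, rfl⟩
  fox_mul g h := by
    obtain ⟨v, rfl⟩ := QuotientGroup.mk_surjective g
    obtain ⟨w, rfl⟩ := QuotientGroup.mk_surjective h
    exact foxPerm_mul_zero R v w
  fox_gen x := by rw [foxQuotient_mk, foxPerm_of, smul_zero, zero_add]
  exists_hom v := by
    obtain ⟨θ, hθ, -⟩ := exists_quotientCommutator_hom hR v
    exact ⟨θ, hθ⟩
  closure_gen := quotientCommutator_closure R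
  proj_hom θ g hg := by
    obtain ⟨θ', hθ', h⟩ := exists_quotientCommutator_hom hR
      fun x => θ (FreeGroup.of x : FreeGroup X)
    rw [← MonoidHom.eq_of_eqOn_dense (quotientCommutator_closure R) (f := θ') (g := θ)
      (by rintro _ ⟨x, rfl⟩; exact hθ' x)]
    exact h g hg
  eq_one_of_fox_eq_zero g hg h := by
    obtain ⟨w, rfl⟩ := QuotientGroup.mk_surjective g
    rw [quotientCommutatorProj_mk_eq_one] at hg
    rw [foxQuotient_mk] at h
    rw [QuotientGroup.eq_one_iff]
    apply mem_commutator_of_abelianization_eq_one R hg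
    apply Additive.ofMul.injective
    rw [← relationMap_foxPerm, h, map_zero, ofMul_one]
  exists_sq g m hg h := by
    obtain ⟨w, rfl⟩ := QuotientGroup.mk_surjective g
    rw [quotientCommutatorProj_mk_eq_one] at hg
    rw [foxQuotient_mk] at h
    obtain ⟨⟨r, hr⟩, hrm : Abelianization.of _ = _⟩ := QuotientGroup.mk_surjective (relationMap R m).toMul
    refine ⟨r, (quotientCommutatorProj_mk_eq_one R).2 hr, ?_⟩
    rw [← QuotientGroup.mk_pow, QuotientGroup.eq]
    apply mem_commutator_of_abelianization_eq_one R (R.mul_mem (R.inv_mem hg) (R.pow_mem hr 2))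
    have hw : Abelianization.of (⟨w, hg⟩ : R) = Abelianization.of ⟨r, hr⟩ ^ 2 := by
      apply Additive.ofMul.injective
      rw [← relationMap_foxPerm, h, map_zsmul, hrm, ofMul_pow, ofMul_toMul]
      exact ofNat_zsmul _ 2
    have : (⟨w⁻¹ * r ^ 2, R.mul_mem (R.inv_mem hg) (R.pow_mem hr 2)⟩ : R) =
      ⟨w, hg⟩⁻¹ * ⟨r, hr⟩ ^ 2 := rfl
    rw [this, map_mul, map_inv, map_pow, hw, inv_mul_cancel]
  proj_gen_ne_one x h :=
    of_notMem_of_ne_top hR hRproper x ((quotientCommutatorProj_mk_eq_one R).1 h)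
  torsionFree := hTF

end Extension

end FreeGroupQuotient

theorem MagnusExtension.exists_proj_eq_one_ne_one {X G Q : Type*} [Group G] [Group Q]
    (E : MagnusExtension X G Q) [Nontrivial X]
    (hDyer : ∀ φ : MulAut G, (∀ r, E.proj r = 1 → φ r = r) →
      ∃ c, E.proj c = 1 ∧ ∀ g, φ g = c * g * c⁻¹) : ∃ r, E.proj r = 1 ∧ r ≠ 1 := by
  classical
  by_contra! h
  obtain ⟨x, y, hxy⟩ := exists_pair_ne X
  obtain ⟨φ, hφ⟩ := E.exists_mulAut_perm (Equiv.swap x y)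
  obtain ⟨c, hc, hcφ⟩ := hDyer φ fun r hr => by rw [h r hr, map_one]
  have hgen := hcφ (E.gen x)
  rw [hφ, Equiv.swap_apply_left, h c hc, one_mul, inv_one, mul_one] at hgen
  have hfox := congrArg E.fox hgen
  rw [E.fox_gen, E.fox_gen] at hfox
  exact hxy (Finsupp.single_left_injective one_ne_zero hfox).symm

/-- Let `F = FreeGroup X` with `X` infinite and let `R` be a fully invariant subgroup
of `F` such that `F/R` is nontrivial and torsion-free, all units of the group ring
`ℤ[F/R]` are trivial, and every automorphism of `G = F/R'` fixing `R̂ = R/R'` pointwise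
is an inner automorphism of `G` determined by an element of `R̂` (Dyer's condition).
Then `Aut (F/R')` is complete: its center is trivial and all of its automorphisms are
inner. -/
theorem aut_FmodRder_complete
    {X : Type*} [Infinite X] (R : Subgroup (FreeGroup X)) [R.Normal]
    (hR : ∀ f : FreeGroup X →* FreeGroup X, R.map f ≤ R)
    (hRproper : R ≠ ⊤)
    (hTF : ∀ g : FreeGroup X ⧸ R, g ≠ 1 → ∀ n : ℕ, n ≠ 0 → g ^ n ≠ 1)
    (hUnits : ∀ u : (MonoidAlgebra ℤ (FreeGroup X ⧸ R))ˣ,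
      ∃ g : FreeGroup X ⧸ R,
        (u : MonoidAlgebra ℤ (FreeGroup X ⧸ R)) = MonoidAlgebra.of ℤ (FreeGroup X ⧸ R) g ∨
        (u : MonoidAlgebra ℤ (FreeGroup X ⧸ R)) = -MonoidAlgebra.of ℤ (FreeGroup X ⧸ R) g)
    (hDyer : ∀ φ : MulAut (FreeGroup X ⧸ ⁅R, R⁆),
      (∀ r ∈ R.map (QuotientGroup.mk' ⁅R, R⁆), φ r = r) →
      ∃ r ∈ R.map (QuotientGroup.mk' ⁅R, R⁆),
        ∀ g : FreeGroup X ⧸ ⁅R, R⁆, φ g = r * g * r⁻¹) :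
    Subgroup.center (MulAut (FreeGroup X ⧸ ⁅R, R⁆)) = ⊥ ∧
    ∀ Φ : MulAut (MulAut (FreeGroup X ⧸ ⁅R, R⁆)),
      ∃ ψ : MulAut (FreeGroup X ⧸ ⁅R, R⁆),
        ∀ φ : MulAut (FreeGroup X ⧸ ⁅R, R⁆), Φ φ = ψ * φ * ψ⁻¹ := by
  let E := FreeGroupQuotient.magnusExtension hR hRproper hTF
  have hmem : ∀ g, E.proj g = 1 ↔ g ∈ R.map (QuotientGroup.mk' ⁅R, R⁆) := fun g =>
    FreeGroupQuotient.quotientCommutatorProj_eq_one R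
  have hE : ∀ φ : MulAut (FreeGroup X ⧸ ⁅R, R⁆), (∀ r, E.proj r = 1 → φ r = r) →
      ∃ c, E.proj c = 1 ∧ ∀ g, φ g = c * g * c⁻¹ := by
    simpa only [hmem] using hDyer
  have hker := E.exists_proj_eq_one_ne_one hE
  exact ⟨MagnusExtension.center_mulAut_eq_bot hker,
    MagnusExtension.exists_mulAut_eq_conj hE hker hUnits⟩
end
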